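/- arXiv:2406.19252 — 3 statements merged into one kernel-verified Lean document; each statement's English description precedes it below -/
import Mathlib

section
/- Let n ≥ 1 and let X ⊆ S^{n-1} be non-empty and closed. Then there exists a discrete set E ⊆ 𝔻ⁿ which is separated and well-approximated, with L_rad(E) = X and δ(E) = dim_H X; moreover every separated and well-approximated discrete E ⊆ 𝔻ⁿ with L_rad(E) = X satisfies δ(E) ≥ dim_H X. Consequently, the Hausdorff dimension of X equals the minimum of δ(E) over all separated and well-approximated discrete E ⊆ 𝔻ⁿ with L_rad(E) = X. -/
open Metric Set Filter
open scoped ENNReal NNReal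

noncomputable section

/-- Points of `ℝⁿ` (Euclidean space). -/
abbrev Pt (n : ℕ) := EuclideanSpace ℝ (Fin n)

/-- `E` is a discrete set: every point of `E` is isolated in `E`. -/
def IsDiscreteSet {n : ℕ} (E : Set (Pt n)) : Prop :=
  ∀ x ∈ E, ∃ r > 0, closedBall x r ∩ E = {x}

/-- The limit set `L(E) = cl(E) \ E`. -/
def limitSet {n : ℕ} (E : Set (Pt n)) : Set (Pt n) := closure E \ E

/-- `E ⊆ 𝔻ⁿ` is separated. -/
def SeparatedSet {n : ℕ} (E : Set (Pt n)) : Prop :=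
  ∃ c₁ : ℝ, 0 < c₁ ∧ c₁ < 1 ∧ ∀ x ∈ E, closedBall x (c₁ * (1 - ‖x‖)) ∩ E = {x}

/-- `E ⊆ 𝔻ⁿ` is well-approximated. -/
def WellApproximated {n : ℕ} (E : Set (Pt n)) : Prop :=
  ∃ c₂ : ℝ, 1 ≤ c₂ ∧ ∀ x ∈ E, ∃ z ∈ limitSet E, dist x z ≤ c₂ * (1 - ‖x‖)

/-- `E` is `α`-separated. -/
def AlphaSeparated {n : ℕ} (E : Set (Pt n)) (α : ℝ) : Prop :=
  ∃ c₁ : ℝ, 0 < c₁ ∧ ∀ x ∈ E, closedBall x (c₁ * (1 - ‖x‖) ^ α) ∩ E = {x}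

/-- `E` is `β`-well-approximated. -/
def BetaWellApproximated {n : ℕ} (E : Set (Pt n)) (β : ℝ) : Prop :=
  ∃ c₂ : ℝ, 1 ≤ c₂ ∧ ∀ x ∈ E, ∃ z ∈ limitSet E, dist x z ≤ c₂ * (1 - ‖x‖) ^ β

/-- The accumulation series `S_E(s) = ∑_{x ∈ E} (1 - |x|)^s` (valued in `ℝ≥0∞`). -/
def accSeries {n : ℕ} (E : Set (Pt n)) (s : ℝ) : ℝ≥0∞ :=
  ∑' x : E, ENNReal.ofReal ((1 - ‖(x : Pt n)‖) ^ s)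

/-- The critical exponent `δ(E) = inf { s ≥ 0 : S_E(s) < ∞ }`, with `inf ∅ = ∞`. -/
def critExp {n : ℕ} (E : Set (Pt n)) : ℝ≥0∞ :=
  ⨅ (s : ℝ≥0) (_ : accSeries E (s : ℝ) < ⊤), (s : ℝ≥0∞)

/-- The set of `c`-radial limit points of `E`. -/
def radialPoints {n : ℕ} (E : Set (Pt n)) (c : ℝ) : Set (Pt n) :=
  {z | ‖z‖ = 1 ∧ ∀ r > 0, ∃ x ∈ E,
    dist x z ≤ c * (1 - ‖x‖) ∧ c * (1 - ‖x‖) ≤ c * r}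

/-- The radial limit set `L_rad(E) = ⋃_{c ≥ 1} L_c(E)`. -/
def radialLimitSet {n : ℕ} (E : Set (Pt n)) : Set (Pt n) :=
  ⋃ c ∈ Ici (1 : ℝ), radialPoints E c

/-- The set of `(γ, c)`-radial limit points of `E`. -/
def gammaRadialPoints {n : ℕ} (E : Set (Pt n)) (γ c : ℝ) : Set (Pt n) :=
  {z | z ∈ limitSet E ∧ ∀ r > 0, ∃ x ∈ E,
    dist x z ≤ c * (1 - ‖x‖) ^ γ ∧ c * (1 - ‖x‖) ^ γ ≤ c * r ^ γ}

/-- The `γ`-radial limit set `L_rad^γ(E) = ⋃_{c ≥ 1} L_c^γ(E)`. -/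
def gammaRadialLimitSet {n : ℕ} (E : Set (Pt n)) (γ : ℝ) : Set (Pt n) :=
  ⋃ c ∈ Ici (1 : ℝ), gammaRadialPoints E γ c

/-- The packing number `N_δ(F)`: the maximal cardinality of a packing of `F` by
pairwise disjoint closed balls of radius `δ` centred in `F`. -/
def packingNumber {n : ℕ} (F : Set (Pt n)) (δ : ℝ) : ℕ∞ :=
  ⨆ (Z : Finset (Pt n)) (_ : ↑Z ⊆ F)
    (_ : (Z : Set (Pt n)).PairwiseDisjoint fun x => closedBall x δ), (Z.card : ℕ∞)

/-- The upper box dimension `limsup_{δ → 0⁺} log N_δ(F) / (-log δ)`. -/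
def upperBoxDim {n : ℕ} (F : Set (Pt n)) : ℝ≥0∞ :=
  limsup (fun δ : ℝ =>
    ENNReal.ofReal (Real.log ((packingNumber F δ).toNat : ℝ) / (-Real.log δ)))
    (nhdsWithin 0 (Ioi 0))

/-- The lower box dimension `liminf_{δ → 0⁺} log N_δ(F) / (-log δ)`. -/
def lowerBoxDim {n : ℕ} (F : Set (Pt n)) : ℝ≥0∞ :=
  liminf (fun δ : ℝ =>
    ENNReal.ofReal (Real.log ((packingNumber F δ).toNat : ℝ) / (-Real.log δ)))
    (nhdsWithin 0 (Ioi 0))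

lemma lower_aux {n : ℕ} (E : Set (Pt n)) (hE : E ⊆ ball 0 1) (s : ℝ≥0)
    (h : accSeries E s < ⊤) : dimH (radialLimitSet E) ≤ s := by
  have hpos : ∀ x : E, 0 < 1 - ‖(x : Pt n)‖ := fun x => by
    have := hE x.2
    simp at this; linarith
  have hcount : Countable E := by
    have h1 := Summable.countable_support_ennreal (ne_of_lt h)
    have h2 : Function.support (fun x : E => ENNReal.ofReal ((1 - ‖(x : Pt n)‖) ^ (s : ℝ))) = univ := by
      ext x
      simp only [Function.mem_support, mem_univ, iff_true]
      have := Real.rpow_pos_of_pos (hpos x) s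
      simpa using this
    rw [h2] at h1
    exact countable_univ_iff.1 h1
  have hsub : radialLimitSet E ⊆ ⋃ m : ℕ, radialPoints E ((m : ℝ) + 1) := by
    intro z hz
    simp only [radialLimitSet, mem_iUnion, mem_Ici] at hz
    obtain ⟨c, hc, hz1, hz2⟩ := hz
    obtain ⟨m, hm⟩ := exists_nat_ge c
    refine mem_iUnion.2 ⟨m, hz1, fun r hr => ?_⟩
    obtain ⟨x, hx, h1, h2⟩ := hz2 r hr
    have hp := hpos ⟨x, hx⟩
    simp only at hp
    refine ⟨x, hx, h1.trans ?_, ?_⟩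
    · gcongr; linarith
    · have := le_of_mul_le_mul_left h2 (by linarith)
      gcongr
  refine (dimH_mono hsub).trans ?_
  rw [dimH_iUnion]
  refine iSup_le fun m => dimH_le_of_hausdorffMeasure_ne_top ?_
  set c : ℝ := (m : ℝ) + 1 with hc
  have hc0 : 0 < c := by positivity
  classical
  let t : ℕ → E → Set (Pt n) := fun k x =>
    if 1 - ‖(x : Pt n)‖ ≤ 1 / ((k : ℝ) + 1) then closedBall (x : Pt n) (c * (1 - ‖(x : Pt n)‖)) else ∅
  have hdiam : ∀ k x, ediam (t k x) ≤ ENNReal.ofReal (2 * c * (1 - ‖(x : Pt n)‖)) := by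
    intro k x
    simp only [t]
    split_ifs
    · refine ediam_le fun a ha b hb => ?_
      rw [edist_dist]
      apply ENNReal.ofReal_le_ofReal
      have := dist_triangle_right a b (x : Pt n)
      rw [mem_closedBall] at ha hb
      linarith
    · simp
  have key := MeasureTheory.Measure.hausdorffMeasure_le_liminf_tsum (s : ℝ) (radialPoints E c)
    (l := atTop) (fun k : ℕ => ENNReal.ofReal (2 * c * (1 / ((k : ℝ) + 1)))) ?_ t ?_ ?_
  · refine ne_of_lt (key.trans_lt ?_)
    refine lt_of_le_of_lt (b := ENNReal.ofReal ((2 * c) ^ (s : ℝ)) * accSeries E s) ?_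
      (ENNReal.mul_lt_top ENNReal.ofReal_lt_top h)
    refine liminf_le_of_frequently_le' (Eventually.frequently (Eventually.of_forall fun k => ?_))
    rw [accSeries, ← ENNReal.tsum_mul_left]
    refine ENNReal.tsum_le_tsum fun x => ?_
    refine (ENNReal.rpow_le_rpow (hdiam k x) s.2).trans ?_
    have := hpos x
    rw [ENNReal.ofReal_rpow_of_nonneg (by positivity) s.2, ← ENNReal.ofReal_mul (by positivity),
      Real.mul_rpow (by positivity) this.le]
    exact le_rfl
  · rw [← ENNReal.ofReal_zero]
    apply ENNReal.tendsto_ofReal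
    simpa using (tendsto_one_div_add_atTop_nhds_zero_nat (𝕜 := ℝ)).const_mul (2 * c)
  · refine Eventually.of_forall fun k x => ?_
    by_cases hk : 1 - ‖(x : Pt n)‖ ≤ 1 / ((k : ℝ) + 1)
    · refine (hdiam k x).trans (ENNReal.ofReal_le_ofReal ?_)
      gcongr
    · simp only [t, if_neg hk]; simp
  · refine Eventually.of_forall fun k z hz => ?_
    obtain ⟨x, hx, h1, h2⟩ := hz.2 (1 / ((k : ℝ) + 1)) (by positivity)
    have h3 := le_of_mul_le_mul_left h2 hc0
    refine mem_iUnion.2 ⟨⟨x, hx⟩, ?_⟩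
    simp only [t, if_pos h3]
    rw [mem_closedBall, dist_comm]; exact h1

lemma cover_aux {n : ℕ} (X : Set (Pt n)) (hX : X ⊆ sphere 0 1) (hXc : IsCompact X)
    (s : ℝ≥0) (hs : 0 < s) (hm : MeasureTheory.Measure.hausdorffMeasure (s : ℝ) X = 0)
    (ε : ℝ) (hε : 0 < ε) (hε2 : ε ≤ 1 / 2) :
    ∃ A : Set (Pt n), A.Finite ∧ (∀ x ∈ A, 0 < 1 - ‖x‖ ∧ 1 - ‖x‖ ≤ ε ∧
        ∃ z ∈ X, dist x z ≤ 1 - ‖x‖) ∧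
      (∀ w ∈ X, ∃ x ∈ A, dist x w ≤ 3 * (1 - ‖x‖)) ∧
      accSeries A s ≤ ENNReal.ofReal ε := by
  rw [MeasureTheory.Measure.hausdorffMeasure_apply] at hm
  have hm1 := le_of_eq hm
  have hε' : 0 < ENNReal.ofReal ε := ENNReal.ofReal_pos.2 hε
  have hε2' : 0 < ENNReal.ofReal (ε / 2) := ENNReal.ofReal_pos.2 (by positivity)
  have hm2 := lt_of_le_of_lt ((iSup₂_le_iff.1 hm1) (ENNReal.ofReal ε) hε') hε2'
  simp only [iInf_lt_iff] at hm2
  obtain ⟨t, htX, htd, hsum⟩ := hm2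
  obtain ⟨e, he0, hes⟩ := ENNReal.exists_pos_sum_of_countable hε2'.ne' ℕ
  let ρ : ℕ → ℝ := fun i => min ε ((e i : ℝ) ^ (1 / (s : ℝ)))
  have hρ0 : ∀ i, 0 < ρ i := fun i => lt_min hε (Real.rpow_pos_of_pos (he0 i) _)
  have hs' : (0 : ℝ) < s := hs
  have hρs : ∀ i, ρ i ^ (s : ℝ) ≤ e i := fun i => by
    calc ρ i ^ (s : ℝ) ≤ ((e i : ℝ) ^ (1 / (s : ℝ))) ^ (s : ℝ) :=
          Real.rpow_le_rpow (hρ0 i).le (min_le_right _ _) hs'.le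
      _ = e i := by
          rw [← Real.rpow_mul (e i).coe_nonneg, one_div_mul_cancel hs'.ne', Real.rpow_one]
  have hfin : ∀ i, ediam (t i) ≠ ⊤ := fun i => ne_of_lt ((htd i).trans_lt ENNReal.ofReal_lt_top)
  let R : ℕ → ℝ := fun i => max (ediam (t i)).toReal (ρ i)
  have hR0 : ∀ i, 0 < R i := fun i => (hρ0 i).trans_le (le_max_right _ _)
  have hRε : ∀ i, R i ≤ ε := fun i =>
    max_le (ENNReal.toReal_le_of_le_ofReal hε.le (htd i)) (min_le_left _ _)
  have hRs : ∀ i, (t i).Nonempty → ENNReal.ofReal (R i ^ (s : ℝ)) ≤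
      (⨆ _ : (t i).Nonempty, ediam (t i) ^ (s : ℝ)) + e i := by
    intro i hi
    rw [ciSup_pos hi]
    rcases max_choice (ediam (t i)).toReal (ρ i) with h | h
    · have : R i = (ediam (t i)).toReal := h
      rw [this, ← ENNReal.ofReal_rpow_of_nonneg ENNReal.toReal_nonneg hs'.le,
        ENNReal.ofReal_toReal (hfin i)]
      exact le_self_add
    · have : R i = ρ i := h
      rw [this]
      refine le_add_left ?_
      refine (ENNReal.ofReal_le_ofReal (hρs i)).trans ?_
      simp
  have hz : ∀ i : {i // (t i ∩ X).Nonempty}, ∃ z, z ∈ t i ∩ X := fun i => i.2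
  choose z hz using hz
  obtain ⟨b, hb⟩ := hXc.elim_finite_subcover
    (fun i : {i // (t i ∩ X).Nonempty} => ball (z i) (2 * R i)) (fun i => isOpen_ball) (by
      intro w hw
      obtain ⟨i, hi⟩ := mem_iUnion.1 (htX hw)
      refine mem_iUnion.2 ⟨⟨i, w, hi, hw⟩, ?_⟩
      rw [mem_ball]
      have h1 := edist_le_ediam_of_mem hi (hz ⟨i, w, hi, hw⟩).1
      have h2 : dist w (z ⟨i, w, hi, hw⟩) ≤ R i := by
        refine le_trans ?_ (le_max_left _ _)
        rw [dist_edist]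
        exact ENNReal.toReal_mono (hfin i) h1
      have := hR0 i
      simp only
      linarith)
  let f : {i // (t i ∩ X).Nonempty} → Pt n := fun i => (1 - R i) • z i
  have hzn : ∀ i, ‖z i‖ = 1 := fun i => by simpa using hX (hz i).2
  have hf : ∀ i, 1 - ‖f i‖ = R i := fun i => by
    have := hRε i
    simp only [f, norm_smul, hzn, Real.norm_eq_abs]
    rw [abs_of_nonneg (by linarith)]; ring
  have hfz : ∀ i, dist (f i) (z i) = R i := fun i => by
    have : f i - z i = (-R i) • z i := by simp only [f]; module
    rw [dist_eq_norm, this, norm_smul, hzn, norm_neg, Real.norm_eq_abs, abs_of_pos (hR0 i), mul_one]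
  refine ⟨f '' (b : Set _), b.finite_toSet.image f, ?_, ?_, ?_⟩
  · rintro _ ⟨i, -, rfl⟩
    rw [hf]
    exact ⟨hR0 i, hRε i, z i, (hz i).2, (hfz i).le⟩
  · intro w hw
    obtain ⟨i, hi, hwi⟩ := mem_iUnion₂.1 (hb hw)
    refine ⟨f i, ⟨i, hi, rfl⟩, ?_⟩
    rw [hf]
    have h1 := dist_triangle (f i) (z i) w
    rw [mem_ball, dist_comm] at hwi
    have := hfz i
    linarith
  · let g : Pt n → ℝ≥0∞ := fun x => ENNReal.ofReal ((1 - ‖x‖) ^ (s : ℝ))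
    calc accSeries (f '' (b : Set _)) s ≤ ∑' x : range f, g x :=
          ENNReal.tsum_mono_subtype g (image_subset_range _ _)
      _ ≤ ∑' i, g (f i) :=
          ENNReal.tsum_le_tsum_comp_of_surjective (f := rangeFactorization f)
            rangeFactorization_surjective (fun x => g x)
      _ ≤ ∑' i : {i // (t i ∩ X).Nonempty},
            ((⨆ _ : (t i).Nonempty, ediam (t i) ^ (s : ℝ)) + e i) := by
          refine ENNReal.tsum_le_tsum fun i => ?_
          simp only [g, hf]
          exact hRs i (i.2.mono inter_subset_left)
      _ ≤ ∑' i, ((⨆ _ : (t i).Nonempty, ediam (t i) ^ (s : ℝ)) + e i) :=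
          ENNReal.tsum_comp_le_tsum_of_injective Subtype.val_injective
            (fun i : ℕ => ((⨆ _ : (t i).Nonempty, ediam (t i) ^ (s : ℝ)) + (e i : ℝ≥0∞)))
      _ = (∑' i, ⨆ _ : (t i).Nonempty, ediam (t i) ^ (s : ℝ)) + ∑' i, (e i : ℝ≥0∞) :=
          ENNReal.tsum_add
      _ ≤ ENNReal.ofReal (ε / 2) + ENNReal.ofReal (ε / 2) := add_le_add hsum.le hes.le
      _ = ENNReal.ofReal ε := by
          rw [← ENNReal.ofReal_add (by positivity) (by positivity)]; congr 1; ring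

lemma maximal_aux {n : ℕ} (F : Set (Pt n)) :
    ∃ E ⊆ F, (∀ x ∈ E, ∀ y ∈ E, x ≠ y → 1 / 8 * max (1 - ‖x‖) (1 - ‖y‖) < dist x y) ∧
      ∀ x ∈ F, 0 < 1 - ‖x‖ → ∃ y ∈ E, dist x y ≤ 1 / 8 * max (1 - ‖x‖) (1 - ‖y‖) := by
  let R : Pt n → Pt n → Prop := fun x y => 1 / 8 * max (1 - ‖x‖) (1 - ‖y‖) < dist x y
  have hsymm : ∀ x y, R x y → R y x := fun x y h => by
    simp only [R] at h ⊢
    rwa [max_comm, dist_comm]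
  obtain ⟨E, hE⟩ := zorn_subset {E : Set (Pt n) | E ⊆ F ∧ E.Pairwise R} (by
    intro c hc hchain
    refine ⟨⋃₀ c, ⟨sUnion_subset fun s hs => (hc hs).1, ?_⟩, fun s hs => subset_sUnion_of_mem hs⟩
    rw [hchain.pairwise_sUnion]
    exact fun s hs => (hc hs).2)
  refine ⟨E, hE.prop.1, fun x hx y hy hxy => hE.prop.2 hx hy hxy, fun x hx hx0 => ?_⟩
  by_contra! hcon
  have hins : insert x E ∈ {E : Set (Pt n) | E ⊆ F ∧ E.Pairwise R} := by
    refine ⟨insert_subset hx hE.prop.1, ?_⟩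
    refine hE.prop.2.insert fun y hy _ => ⟨hcon y hy, hsymm _ _ (hcon y hy)⟩
  have hxE : x ∈ E := hE.le_of_ge hins (subset_insert x E) (mem_insert x E)
  have := hcon x hxE
  simp at this
  linarith

lemma exists_aux {n : ℕ} 
    (X : Set (Pt n)) (hX : X ⊆ sphere 0 1) (hXcl : IsClosed X) :
    ∃ E : Set (Pt n), E ⊆ ball 0 1 ∧ IsDiscreteSet E ∧ SeparatedSet E ∧
        WellApproximated E ∧ radialLimitSet E = X ∧ critExp E ≤ dimH X := by
  have hXc : IsCompact X := (isCompact_sphere _ _).of_isClosed_subset hXcl hX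
  have hfin : dimH X ≠ ⊤ := by
    refine ne_of_lt ((dimH_mono (subset_univ X)).trans_lt ?_)
    rw [Real.dimH_univ_eq_finrank]
    exact ENNReal.natCast_lt_top _
  obtain ⟨d, hd⟩ : ∃ d : ℝ≥0, (d : ℝ≥0∞) = dimH X := ⟨_, ENNReal.coe_toNNReal hfin⟩
  let σ : ℕ → ℝ≥0 := fun k => d + 1 / ((k : ℝ≥0) + 1)
  have hcov := fun k : ℕ => cover_aux X hX hXc (σ k) (by positivity)
    (hausdorffMeasure_of_dimH_lt (by
      rw [← hd, ENNReal.coe_lt_coe]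
      exact lt_add_of_pos_right _ (by positivity)))
    ((1 / 2) ^ (k + 1)) (by positivity) (by
      rw [pow_succ]
      have : ((1 : ℝ) / 2) ^ k ≤ 1 := pow_le_one₀ (by norm_num) (by norm_num)
      linarith)
  choose A hAfin hA hAX hAs using hcov
  obtain ⟨E, hEF, hsep, hmax⟩ := maximal_aux (⋃ k, A k)
  have hE : ∀ x ∈ E, 0 < 1 - ‖x‖ ∧ ∃ z ∈ X, dist x z ≤ 1 - ‖x‖ := by
    intro x hx
    obtain ⟨k, hk⟩ := mem_iUnion.1 (hEF hx)
    exact ⟨(hA k x hk).1, (hA k x hk).2.2⟩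
  have hball : E ⊆ ball 0 1 := fun x hx => by
    have := (hE x hx).1
    rw [mem_ball_zero_iff]; linarith
  have hS : ∀ x ∈ E, closedBall x (1 / 8 * (1 - ‖x‖)) ∩ E = {x} := by
    intro x hx
    have h0 := (hE x hx).1
    ext y
    simp only [mem_inter_iff, mem_closedBall, mem_singleton_iff]
    refine ⟨fun ⟨h1, h2⟩ => ?_, ?_⟩
    · by_contra hne
      have h3 := hsep y h2 x hx hne
      have := le_max_right (1 - ‖y‖) (1 - ‖x‖)
      linarith
    · rintro rfl
      refine ⟨?_, hx⟩
      rw [dist_self]; positivity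
  have hrad : ∀ w ∈ X, ∀ r > 0, ∃ y ∈ E, dist y w ≤ 4 * (1 - ‖y‖) ∧ 1 - ‖y‖ ≤ r := by
    intro w hw r hr
    obtain ⟨k, hk⟩ := exists_pow_lt_of_lt_one hr (show (1 / 2 : ℝ) < 1 by norm_num)
    obtain ⟨x, hx, hxw⟩ := hAX k w hw
    obtain ⟨h0, hxk, -⟩ := hA k x hx
    obtain ⟨y, hy, hxy⟩ := hmax x (mem_iUnion.2 ⟨k, hx⟩) h0
    have hy0 := (hE y hy).1
    have h1 := abs_le.1 ((abs_norm_sub_norm_le x y).trans_eq (dist_eq_norm x y).symm)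
    have h2 := dist_triangle_left y w x
    rw [pow_succ] at hxk
    refine ⟨y, hy, ?_, ?_⟩ <;>
    · rcases le_total (1 - ‖x‖) (1 - ‖y‖) with h | h
      · rw [max_eq_right h] at hxy
        linarith
      · rw [max_eq_left h] at hxy
        linarith
  have hlim : X ⊆ limitSet E := by
    intro w hw
    refine ⟨Metric.mem_closure_iff.2 fun ε hε => ?_, fun hwE => ?_⟩
    · obtain ⟨y, hy, h1, h2⟩ := hrad w hw (ε / 8) (by positivity)
      refine ⟨y, hy, ?_⟩
      rw [dist_comm]; linarith
    · have h1 := hball hwE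
      have h2 := hX hw
      simp at h1 h2
      linarith
  refine ⟨E, hball, fun x hx => ⟨_, ?_, hS x hx⟩, ⟨1 / 8, by norm_num, by norm_num, hS⟩,
    ⟨1, le_rfl, fun x hx => ?_⟩, ?_, ?_⟩
  · have := (hE x hx).1
    positivity
  · obtain ⟨-, z, hz, h⟩ := hE x hx
    exact ⟨z, hlim hz, by linarith⟩
  · apply Subset.antisymm
    · intro w hw
      simp only [radialLimitSet, mem_iUnion, mem_Ici] at hw
      obtain ⟨c, hc, -, hw⟩ := hw
      rw [← hXcl.closure_eq]
      refine Metric.mem_closure_iff.2 fun ε hε => ?_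
      have hc0 : 0 < c + 2 := by linarith
      obtain ⟨x, hx, h1, h2⟩ := hw (ε / (c + 2)) (by positivity)
      have h3 := le_of_mul_le_mul_left h2 (by linarith)
      obtain ⟨h0, z, hz, h4⟩ := hE x hx
      refine ⟨z, hz, ?_⟩
      have h5 := dist_triangle_left w z x
      rw [le_div_iff₀ hc0] at h3
      nlinarith
    · intro w hw
      simp only [radialLimitSet, mem_iUnion, mem_Ici]
      refine ⟨4, by norm_num, by simpa using hX hw, fun r hr => ?_⟩
      obtain ⟨y, hy, h1, h2⟩ := hrad w hw r hr
      exact ⟨y, hy, h1, by linarith⟩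
  · refine le_of_forall_gt_imp_ge_of_dense fun b hb => ?_
    obtain ⟨s, hs1, hs2⟩ := ENNReal.lt_iff_exists_nnreal_btwn.1 hb
    refine le_trans ?_ hs2.le
    refine iInf₂_le s ?_
    rw [← hd, ENNReal.coe_lt_coe] at hs1
    obtain ⟨K, hK⟩ := exists_nat_one_div_lt (tsub_pos_of_lt hs1)
    have hσ : ∀ k, σ (k + K) ≤ s := fun k => by
      have h1 : 1 / (((k + K : ℕ) : ℝ≥0) + 1) ≤ 1 / ((K : ℝ≥0) + 1) := by
        gcongr; simp
      calc σ (k + K) ≤ d + (s - d) := add_le_add le_rfl (h1.trans hK.le)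
        _ = s := add_tsub_cancel_of_le hs1.le
    let g : Pt n → ℝ≥0∞ := fun x => ENNReal.ofReal ((1 - ‖x‖) ^ (s : ℝ))
    have h1 : accSeries E s ≤ ∑' k, accSeries (A k) s :=
      (ENNReal.tsum_mono_subtype g hEF).trans (ENNReal.tsum_iUnion_le_tsum g A)
    refine h1.trans_lt ?_
    rw [← Summable.sum_add_tsum_nat_add' (k := K) ENNReal.summable]
    refine ENNReal.add_lt_top.2 ⟨ENNReal.sum_lt_top.2 fun k _ => ?_, ?_⟩
    · have := (hAfin k).fintype
      rw [accSeries, tsum_fintype]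
      exact ENNReal.sum_lt_top.2 fun x _ => ENNReal.ofReal_lt_top
    · have h2 : ∀ k, accSeries (A (k + K)) s ≤ ENNReal.ofReal ((1 / 2) ^ k) := fun k => by
        have : accSeries (A (k + K)) s ≤ accSeries (A (k + K)) (σ (k + K)) := by
          refine ENNReal.tsum_le_tsum fun x => ENNReal.ofReal_le_ofReal ?_
          have h0 := (hA _ x x.2).1
          exact Real.rpow_le_rpow_of_exponent_ge h0 (by linarith [norm_nonneg (x : Pt n)]) (hσ k)
        refine this.trans ((hAs _).trans (ENNReal.ofReal_le_ofReal ?_))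
        exact pow_le_pow_of_le_one (by norm_num) (by norm_num) (by omega)
      refine (ENNReal.tsum_le_tsum h2).trans_lt ?_
      rw [← ENNReal.ofReal_tsum_of_nonneg (fun k => by positivity) summable_geometric_two]
      exact ENNReal.ofReal_lt_top

/-- **Theorem: the Hausdorff dimension of a non-empty closed `X ⊆ S^{n-1}` is the minimum of
`δ(E)` over separated, well-approximated discrete `E ⊆ 𝔻ⁿ` with `L_rad(E) = X`.** -/
theorem dimH_eq_min_critExp {n : ℕ} (hn : 1 ≤ n)
    (X : Set (Pt n)) (hX : X ⊆ sphere 0 1) (hXne : X.Nonempty) (hXcl : IsClosed X) :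
    (∃ E : Set (Pt n), E ⊆ ball 0 1 ∧ IsDiscreteSet E ∧ SeparatedSet E ∧
        WellApproximated E ∧ radialLimitSet E = X ∧ critExp E = dimH X) ∧
      ∀ E : Set (Pt n), E ⊆ ball 0 1 → IsDiscreteSet E → SeparatedSet E →
        WellApproximated E → radialLimitSet E = X → dimH X ≤ critExp E := by
  have hlow : ∀ E : Set (Pt n), E ⊆ ball 0 1 → radialLimitSet E = X → dimH X ≤ critExp E := by
    intro E hE hEX
    rw [← hEX]
    exact le_iInf₂ fun s hs => lower_aux E hE s hs
  refine ⟨?_, fun E hE _ _ _ hEX => hlow E hE hEX⟩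
  obtain ⟨E, h1, h2, h3, h4, h5, h6⟩ := exists_aux X hX hXcl
  exact ⟨E, h1, h2, h3, h4, h5, le_antisymm h6 (hlow E h1 h5)⟩

end
end

section
/- Let n ≥ 2, let 0 < β ≤ 1 ≤ α, and let w ∈ S^{n-1}. There exists a discrete set E ⊆ 𝔻ⁿ which is α-separated and β-well-approximated, with limit set L(E) = {w} (so the upper box dimension of L(E) is 0) and critical exponent δ(E) = nα − (n−1)β − 1. Hence the lower bound upper box dim L(E) ≥ δ(E) − 2(nα − (n−1)β − 1) cannot be improved to upper box dim L(E) ≥ δ(E) − c(nα − (n−1)β − 1) for any c < 1 uniformly in such examples; in particular the correction term in that inequality cannot be removed. -/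
open Metric Set Filter
open scoped ENNReal NNReal

noncomputable section

/-! Construction of the example -/

/-- scale of the `k`-th shell -/
def qs (k : ℕ) : ℝ := (1 / 4 : ℝ) ^ (k + 1)

lemma qs_pos (k : ℕ) : 0 < qs k := by unfold qs; positivity

lemma qs_le (k : ℕ) : qs k ≤ 1 / 4 := by
  unfold qs
  rw [pow_succ]
  have : (1 / 4 : ℝ) ^ k ≤ 1 := pow_le_one₀ (by norm_num) (by norm_num)
  linarith

lemma qs_lt {k l : ℕ} (h : k < l) : 4 * qs l ≤ qs k := by
  have h1 : qs l ≤ qs (k + 1) := by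
    unfold qs
    exact pow_le_pow_of_le_one (by norm_num) (by norm_num) (by omega)
  have h2 : 4 * qs (k + 1) = qs k := by unfold qs; rw [pow_succ _ (k + 1)]; ring
  linarith

lemma qs_tendsto : Tendsto qs atTop (nhds 0) := by
  have := tendsto_pow_atTop_nhds_zero_of_lt_one (r := (1 / 4 : ℝ)) (by norm_num) (by norm_num)
  exact (tendsto_add_atTop_iff_nat 1).2 this

lemma one_le_rpow_qs (k : ℕ) {e : ℝ} (he : e ≤ 0) : 1 ≤ qs k ^ e :=
  Real.one_le_rpow_of_pos_of_le_one_of_nonpos (qs_pos k) (by linarith [qs_le k]) he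

/-- number of grid steps -/
def gridN (e : ℝ) (k : ℕ) : ℕ := ⌊qs k ^ e⌋₊

lemma gridN_pos (k : ℕ) {e : ℝ} (he : e ≤ 0) : 1 ≤ (gridN e k : ℝ) := by
  have : 1 ≤ gridN e k := Nat.le_floor (by simpa using one_le_rpow_qs k he)
  exact_mod_cast this

lemma gridN_le (k : ℕ) (e : ℝ) : (gridN e k : ℝ) ≤ qs k ^ e :=
  Nat.floor_le (Real.rpow_nonneg (qs_pos k).le _)

lemma le_gridN (k : ℕ) {e : ℝ} (he : e ≤ 0) : qs k ^ e / 2 ≤ (gridN e k : ℝ) := by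
  have h1 := gridN_pos k he
  have h2 : qs k ^ e < (gridN e k : ℝ) + 1 := Nat.lt_floor_add_one _
  linarith

/-- index type -/
abbrev Idx (d : ℕ) (α β : ℝ) : Type :=
  Σ k : ℕ, Fin (gridN (1 - α) k) × (Fin d → Fin (gridN (β - α) k))

/-- depth -/
def tv {d : ℕ} {α β : ℝ} (i : Idx d α β) : ℝ :=
  qs i.1 * (1 + (i.2.1 : ℕ) / (gridN (1 - α) i.1 : ℝ))

lemma tv_ge {d : ℕ} {α β : ℝ} (i : Idx d α β) : qs i.1 ≤ tv i := by
  unfold tv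
  have : 0 ≤ ((i.2.1 : ℕ) : ℝ) / (gridN (1 - α) i.1 : ℝ) := by positivity
  nlinarith [qs_pos i.1]

lemma tv_le {d : ℕ} {α β : ℝ} (i : Idx d α β) : tv i ≤ 2 * qs i.1 := by
  unfold tv
  have : ((i.2.1 : ℕ) : ℝ) / (gridN (1 - α) i.1 : ℝ) ≤ 1 := by
    apply div_le_one_of_le₀
    · exact_mod_cast i.2.1.2.le
    · positivity
  nlinarith [qs_pos i.1]

lemma tv_le_half {d : ℕ} {α β : ℝ} (i : Idx d α β) : tv i ≤ 1 / 2 := by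
  linarith [tv_le i, qs_le i.1]

lemma tv_pos {d : ℕ} {α β : ℝ} (i : Idx d α β) : 0 < tv i := by
  linarith [tv_ge i, qs_pos i.1]

/-- tangential vector -/
def vv {d n : ℕ} {α β : ℝ} (e : Fin d → Pt n) (i : Idx d α β) : Pt n :=
  ∑ j, (((i.2.2 j : ℕ) : ℝ) * qs i.1 ^ α / (d + 1)) • e j

/-- the points -/
def pp {d n : ℕ} {α β : ℝ} (w : Pt n) (e : Fin d → Pt n) (i : Idx d α β) : Pt n :=
  (1 - tv i) • (√(1 - ‖vv e i‖ ^ 2) • w + vv e i)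

section
variable {d n : ℕ} {α β : ℝ} {w : Pt n} {e : Fin d → Pt n}

lemma norm_vv (he : Orthonormal ℝ e) (i : Idx d α β) :
    ‖vv e i‖ ≤ qs i.1 ^ β := by
  have hq := qs_pos i.1
  have key : ∀ j, ‖(((i.2.2 j : ℕ) : ℝ) * qs i.1 ^ α / (d + 1)) • e j‖ ≤ qs i.1 ^ β / (d + 1) := by
    intro j
    rw [norm_smul, he.1 j, mul_one, Real.norm_of_nonneg (by positivity)]
    gcongr
    have h1 : ((i.2.2 j : ℕ) : ℝ) ≤ gridN (β - α) i.1 := by exact_mod_cast (i.2.2 j).2.le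
    calc ((i.2.2 j : ℕ) : ℝ) * qs i.1 ^ α ≤ qs i.1 ^ (β - α) * qs i.1 ^ α := by
          gcongr; exact h1.trans (gridN_le _ _)
      _ = qs i.1 ^ β := by rw [← Real.rpow_add hq]; ring_nf
  calc ‖vv e i‖ ≤ ∑ j : Fin d, qs i.1 ^ β / (d + 1) := norm_sum_le_of_le _ fun j _ => key j
    _ = (d : ℝ) / (d + 1) * qs i.1 ^ β := by simp; ring
    _ ≤ 1 * qs i.1 ^ β := by
        gcongr
        apply div_le_one_of_le₀ <;> linarith [Nat.cast_nonneg (α := ℝ) d]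
    _ = _ := one_mul _

lemma norm_vv_le_one (hβ : 0 < β) (he : Orthonormal ℝ e) (i : Idx d α β) : ‖vv e i‖ ≤ 1 :=
  (norm_vv he i).trans (Real.rpow_le_one (qs_pos _).le (by linarith [qs_le i.1]) hβ.le)

lemma inner_e_vv (he : Orthonormal ℝ e) (i : Idx d α β) (j : Fin d) :
    inner ℝ (e j) (vv e i) = ((i.2.2 j : ℕ) : ℝ) * qs i.1 ^ α / (d + 1) := by
  unfold vv
  exact he.inner_right_fintype _ j

lemma inner_w_vv (hew : ∀ j, inner ℝ w (e j) = 0) (i : Idx d α β) :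
    inner ℝ w (vv e i) = 0 := by
  unfold vv
  simp [inner_sum, inner_smul_right, hew]

lemma norm_pp (hw : ‖w‖ = 1) (hβ : 0 < β) (he : Orthonormal ℝ e) (hew : ∀ j, inner ℝ w (e j) = 0)
    (i : Idx d α β) : ‖pp w e i‖ = 1 - tv i := by
  have h1 := norm_vv_le_one hβ he i
  have h2 : 0 ≤ 1 - ‖vv e i‖ ^ 2 := by nlinarith [norm_nonneg (vv e i)]
  have h3 : ‖√(1 - ‖vv e i‖ ^ 2) • w + vv e i‖ ^ 2 = 1 := by
    rw [norm_add_sq_real, inner_smul_left, inner_w_vv hew, norm_smul, hw, Real.norm_of_nonneg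
      (Real.sqrt_nonneg _), mul_one, Real.sq_sqrt h2]
    simp
  have h4 : ‖√(1 - ‖vv e i‖ ^ 2) • w + vv e i‖ = 1 := by
    nlinarith [norm_nonneg (√(1 - ‖vv e i‖ ^ 2) • w + vv e i)]
  unfold pp
  rw [norm_smul, h4, mul_one, Real.norm_of_nonneg (by linarith [tv_le_half i])]

lemma dist_pp_w (hw : ‖w‖ = 1) (hβ : 0 < β) (hβ1 : β ≤ 1) (he : Orthonormal ℝ e)
    (i : Idx d α β) :
    dist (pp w e i) w ≤ 4 * qs i.1 ^ β := by
  have h0 := norm_vv he i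
  have h1 := norm_vv_le_one hβ he i
  have h2 : 0 ≤ 1 - ‖vv e i‖ ^ 2 := by nlinarith [norm_nonneg (vv e i)]
  have hs : √(1 - ‖vv e i‖ ^ 2) ≤ 1 := Real.sqrt_le_one.2 (by nlinarith [norm_nonneg (vv e i)])
  have hs2 : 1 - ‖vv e i‖ ≤ √(1 - ‖vv e i‖ ^ 2) := by
    apply Real.le_sqrt_of_sq_le
    nlinarith [norm_nonneg (vv e i)]
  have hq : qs i.1 ≤ qs i.1 ^ β := by
    simpa using Real.rpow_le_rpow_of_exponent_ge (qs_pos i.1) (by linarith [qs_le i.1]) hβ1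
  have ht := tv_le i
  have ht' := tv_pos i
  have htt := tv_le_half i
  have : pp w e i - w = ((1 - tv i) * √(1 - ‖vv e i‖ ^ 2) - 1) • w + (1 - tv i) • vv e i := by
    unfold pp; module
  rw [dist_eq_norm, this]
  refine (norm_add_le _ _).trans ?_
  rw [norm_smul, norm_smul, hw, mul_one, Real.norm_of_nonneg (by linarith : 0 ≤ 1 - tv i),
    Real.norm_eq_abs]
  have h5 : |(1 - tv i) * √(1 - ‖vv e i‖ ^ 2) - 1| ≤ tv i + ‖vv e i‖ := by
    rw [abs_le]
    constructor <;> nlinarith [norm_nonneg (vv e i), Real.sqrt_nonneg (1 - ‖vv e i‖ ^ 2)]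
  nlinarith [norm_nonneg (vv e i)]

lemma qs_rpow_le (hα : 1 ≤ α) (k : ℕ) : qs k ^ α ≤ qs k := by
  simpa using Real.rpow_le_rpow_of_exponent_ge (qs_pos k) (by linarith [qs_le k]) hα

lemma sep_pp (hw : ‖w‖ = 1) (hβ : 0 < β) (hα : 1 ≤ α)
    (he : Orthonormal ℝ e) (hew : ∀ j, inner ℝ w (e j) = 0)
    (i i' : Idx d α β) (hne : i ≠ i') :
    qs i.1 ^ α / (2 * (d + 1)) ≤ dist (pp w e i) (pp w e i') := by
  have hqa : 0 < qs i.1 ^ α := Real.rpow_pos_of_pos (qs_pos _) _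
  have hd : qs i.1 ^ α / (2 * (d + 1)) ≤ qs i.1 ^ α / 2 := by
    gcongr
    linarith [Nat.cast_nonneg (α := ℝ) d]
  have hdist : |tv i - tv i'| ≤ dist (pp w e i) (pp w e i') := by
    have := abs_norm_sub_norm_le (pp w e i) (pp w e i')
    rw [norm_pp hw hβ he hew, norm_pp hw hβ he hew] at this
    rw [dist_eq_norm]
    refine le_trans (le_of_eq ?_) this
    rw [abs_sub_comm]; congr 1; ring
  have hqq := qs_rpow_le hα i.1
  obtain ⟨k, a, m⟩ := i
  obtain ⟨k', a', m'⟩ := i'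
  rcases lt_trichotomy k k' with hk | hk | hk
  · refine hd.trans (le_trans ?_ hdist)
    have h1 := tv_ge (⟨k, a, m⟩ : Idx d α β)
    have h2 := tv_le (⟨k', a', m'⟩ : Idx d α β)
    have h3 := qs_lt hk
    dsimp only at *
    exact le_trans (by linarith) (le_abs_self _)
  · subst hk
    by_cases ha : a = a'
    · subst ha
      have hm : m ≠ m' := by rintro rfl; exact hne rfl
      obtain ⟨j, hj⟩ := Function.ne_iff.1 hm
      have hj' : (m j : ℕ) ≠ (m' j : ℕ) := fun h => hj (Fin.ext h)
      have h1 : (1 : ℝ) ≤ |((m j : ℕ) : ℝ) - ((m' j : ℕ) : ℝ)| := by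
        have : (1 : ℤ) ≤ |((m j : ℕ) : ℤ) - ((m' j : ℕ) : ℤ)| :=
          Int.one_le_abs (by omega)
        exact_mod_cast this
      have h2 := abs_real_inner_le_norm (e j)
        (pp w e (⟨k, a, m⟩ : Idx d α β) - pp w e (⟨k, a, m'⟩ : Idx d α β))
      rw [he.1 j, one_mul, ← dist_eq_norm] at h2
      refine le_trans ?_ h2
      have hwj : inner ℝ (e j) w = 0 := by rw [real_inner_comm]; exact hew j
      have h3 : inner ℝ (e j) (pp w e (⟨k, a, m⟩ : Idx d α β) - pp w e (⟨k, a, m'⟩ : Idx d α β))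
          = (1 - tv (⟨k, a, m⟩ : Idx d α β)) * (qs k ^ α / (d + 1))
            * (((m j : ℕ) : ℝ) - ((m' j : ℕ) : ℝ)) := by
        have ht : tv (⟨k, a, m'⟩ : Idx d α β) = tv (⟨k, a, m⟩ : Idx d α β) := rfl
        unfold pp
        rw [inner_sub_right, inner_smul_right, inner_smul_right, inner_add_right, inner_add_right,
          inner_smul_right, inner_smul_right, hwj, inner_e_vv he, inner_e_vv he, ht]
        dsimp only
        ring
      have htt := tv_le_half (⟨k, a, m⟩ : Idx d α β)
      rw [h3, abs_mul, abs_of_nonneg (mul_nonneg (by linarith) (by positivity))]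
      dsimp only at *
      have h5 : 0 < qs k ^ α / (d + 1) := by positivity
      have h6 : qs k ^ α / (2 * (d + 1)) = 1 / 2 * (qs k ^ α / (d + 1)) * 1 := by
        field_simp
      rw [h6]
      have h7 : 1 / 2 * (qs k ^ α / (d + 1)) ≤
          (1 - tv (⟨k, a, m⟩ : Idx d α β)) * (qs k ^ α / (d + 1)) :=
        mul_le_mul_of_nonneg_right (by linarith) h5.le
      exact mul_le_mul h7 h1 zero_le_one (le_trans (by positivity) h7)
    · refine hd.trans (le_trans ?_ hdist)
      have ha' : (a : ℕ) ≠ (a' : ℕ) := fun h => ha (Fin.ext h)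
      have h1 : (1 : ℝ) ≤ |((a : ℕ) : ℝ) - ((a' : ℕ) : ℝ)| := by
        have : (1 : ℤ) ≤ |((a : ℕ) : ℤ) - ((a' : ℕ) : ℤ)| :=
          Int.one_le_abs (by omega)
        exact_mod_cast this
      have hN := gridN_pos k (show 1 - α ≤ 0 by linarith)
      have hN2 := gridN_le k (1 - α)
      have hq := qs_pos k
      have h3 : tv (⟨k, a, m⟩ : Idx d α β) - tv (⟨k, a', m'⟩ : Idx d α β)
          = qs k / gridN (1 - α) k * (((a : ℕ) : ℝ) - ((a' : ℕ) : ℝ)) := by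
        unfold tv
        dsimp only
        ring
      have h4 : qs k ^ α ≤ qs k / gridN (1 - α) k := by
        rw [le_div_iff₀ (by linarith)]
        calc qs k ^ α * gridN (1 - α) k ≤ qs k ^ α * qs k ^ (1 - α) := by gcongr
          _ = qs k := by rw [← Real.rpow_add hq]; simp
      rw [h3, abs_mul, abs_of_nonneg (by positivity)]
      dsimp only at *
      nlinarith
  · refine hd.trans (le_trans ?_ hdist)
    have h1 := tv_le (⟨k, a, m⟩ : Idx d α β)
    have h2 := tv_ge (⟨k', a', m'⟩ : Idx d α β)
    have h3 := qs_lt hk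
    have := qs_pos k
    dsimp only at *
    rw [abs_sub_comm]
    exact le_trans (by linarith) (le_abs_self _)

end

lemma exists_frame {d : ℕ} (w : Pt (d + 1)) (hw : ‖w‖ = 1) :
    ∃ e : Fin d → Pt (d + 1), Orthonormal ℝ e ∧ ∀ j, inner ℝ w (e j) = 0 := by
  have : Fact (Module.finrank ℝ (Pt (d + 1)) = d + 1) := ⟨by simp⟩
  have hw0 : w ≠ 0 := by rintro rfl; simp at hw
  have hf := Submodule.finrank_orthogonal_span_singleton (𝕜 := ℝ) (n := d) hw0
  let b := (stdOrthonormalBasis ℝ (Submodule.span ℝ {w})ᗮ).reindex (finCongr hf)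
  refine ⟨fun j => (b j : Pt (d + 1)), ?_, fun j => ?_⟩
  · exact b.orthonormal.comp_linearIsometry (Submodule.subtypeₗᵢ _)
  · exact Submodule.mem_orthogonal_singleton_iff_inner_right.1 (b j).2

lemma upperBoxDim_singleton {n : ℕ} (w : Pt n) : upperBoxDim ({w} : Set (Pt n)) = 0 := by
  have h : ∀ δ : ℝ, Real.log ((_root_.packingNumber ({w} : Set (Pt n)) δ).toNat : ℝ) = 0 := by
    intro δ
    have h1 : _root_.packingNumber ({w} : Set (Pt n)) δ ≤ 1 := by
      unfold _root_.packingNumber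
      refine iSup_le fun Z => iSup_le fun hZ => iSup_le fun _ => ?_
      have : Z ⊆ {w} := by intro z hz; simpa using hZ hz
      exact_mod_cast (by simpa using Finset.card_le_card this : Z.card ≤ 1)
    have h2 : (_root_.packingNumber ({w} : Set (Pt n)) δ).toNat ≤ 1 := by
      simpa using ENat.toNat_le_toNat h1 (by simp)
    interval_cases (_root_.packingNumber ({w} : Set (Pt n)) δ).toNat <;> simp
  unfold upperBoxDim
  simp [h]

/-- size of the shells -/
lemma card_fiber {d : ℕ} {α β : ℝ} (k : ℕ) :
    Fintype.card (Fin (gridN (1 - α) k) × (Fin d → Fin (gridN (β - α) k)))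
      = gridN (1 - α) k * gridN (β - α) k ^ d := by simp

lemma rpow_prod {d : ℕ} {α β : ℝ} (k : ℕ) :
    qs k ^ (1 - α) * (qs k ^ (β - α)) ^ d = qs k ^ (-((d + 1) * α - d * β - 1)) := by
  rw [← Real.rpow_natCast, ← Real.rpow_mul (qs_pos k).le, ← Real.rpow_add (qs_pos k)]
  ring_nf

lemma series_finite {d : ℕ} {α β s : ℝ} (hs0 : 0 ≤ s)
    (hs : (d + 1) * α - d * β - 1 < s) :
    ∑' i : Idx d α β, ENNReal.ofReal (tv i ^ s) < ⊤ := by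
  set D := (d + 1) * α - d * β - 1 with hD
  rw [ENNReal.summable.tsum_sigma' (fun _ => ENNReal.summable)]
  have hb : ∀ k, ∑' b : Fin (gridN (1 - α) k) × (Fin d → Fin (gridN (β - α) k)),
      ENNReal.ofReal (tv (⟨k, b⟩ : Idx d α β) ^ s) ≤
      ENNReal.ofReal (2 ^ s * ((1 / 4 : ℝ) ^ (s - D)) ^ (k + 1)) := by
    intro k
    have hq := qs_pos k
    rw [tsum_fintype]
    calc _ ≤ ∑ b : Fin (gridN (1 - α) k) × (Fin d → Fin (gridN (β - α) k)),
          ENNReal.ofReal (2 ^ s * qs k ^ s) := by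
          refine Finset.sum_le_sum fun b _ => ENNReal.ofReal_le_ofReal ?_
          rw [← Real.mul_rpow (by norm_num) hq.le]
          exact Real.rpow_le_rpow (tv_pos _).le (tv_le (⟨k, b⟩ : Idx d α β)) hs0
      _ = ENNReal.ofReal (((gridN (1 - α) k : ℝ) * (gridN (β - α) k : ℝ) ^ d)
            * (2 ^ s * qs k ^ s)) := by
          rw [Finset.sum_const, Finset.card_univ, card_fiber, nsmul_eq_mul,
            ← ENNReal.ofReal_natCast, ← ENNReal.ofReal_mul (by positivity)]
          push_cast; rfl
      _ ≤ _ := by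
          apply ENNReal.ofReal_le_ofReal
          calc _ ≤ (qs k ^ (1 - α) * (qs k ^ (β - α)) ^ d) * (2 ^ s * qs k ^ s) := by
                gcongr
                · exact gridN_le _ _
                · exact gridN_le _ _
            _ = 2 ^ s * (qs k ^ (-D) * qs k ^ s) := by rw [rpow_prod]; ring
            _ = 2 ^ s * qs k ^ (s - D) := by rw [← Real.rpow_add hq]; ring_nf
            _ = _ := by
              unfold qs
              rw [← Real.rpow_natCast, ← Real.rpow_natCast, ← Real.rpow_mul (by norm_num),
                ← Real.rpow_mul (by norm_num), mul_comm (s - D)]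
            _ ≤ _ := le_rfl
  refine lt_of_le_of_lt (ENNReal.tsum_le_tsum hb) ?_
  have hr : (1 / 4 : ℝ) ^ (s - D) < 1 :=
    Real.rpow_lt_one (by norm_num) (by norm_num) (by linarith)
  have hr0 : 0 ≤ (1 / 4 : ℝ) ^ (s - D) := by positivity
  have hsum : Summable fun k : ℕ => 2 ^ s * ((1 / 4 : ℝ) ^ (s - D)) ^ (k + 1) :=
    (((summable_nat_add_iff 1).2 (summable_geometric_of_lt_one hr0 hr))).mul_left _
  exact lt_top_iff_ne_top.2 hsum.tsum_ofReal_ne_top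

lemma series_infinite {d : ℕ} {α β s : ℝ} (hβα : β ≤ α) (hα : 1 ≤ α) (hs0 : 0 ≤ s)
    (hs : s ≤ (d + 1) * α - d * β - 1) :
    ∑' i : Idx d α β, ENNReal.ofReal (tv i ^ s) = ⊤ := by
  set D := (d + 1) * α - d * β - 1 with hD
  rw [ENNReal.summable.tsum_sigma' (fun _ => ENNReal.summable)]
  have hb : ∀ k, ENNReal.ofReal ((1 / 2) ^ (d + 1)) ≤
      ∑' b : Fin (gridN (1 - α) k) × (Fin d → Fin (gridN (β - α) k)),
      ENNReal.ofReal (tv (⟨k, b⟩ : Idx d α β) ^ s) := by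
    intro k
    have hq := qs_pos k
    rw [tsum_fintype]
    calc _ ≤ ENNReal.ofReal (((gridN (1 - α) k : ℝ) * (gridN (β - α) k : ℝ) ^ d)
            * (qs k ^ s)) := by
          apply ENNReal.ofReal_le_ofReal
          have h1 := le_gridN k (show 1 - α ≤ 0 by linarith)
          have h2 := le_gridN k (show β - α ≤ 0 by linarith)
          calc (1 / 2 : ℝ) ^ (d + 1) ≤ (1 / 2 : ℝ) ^ (d + 1) * qs k ^ (s - D) := by
                have := one_le_rpow_qs k (show s - D ≤ 0 by linarith)
                exact le_mul_of_one_le_right (by positivity) this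
            _ = (1 / 2 : ℝ) ^ (d + 1) * (qs k ^ (-D) * qs k ^ s) := by
                rw [← Real.rpow_add hq]; ring_nf
            _ = (qs k ^ (1 - α) / 2 * (qs k ^ (β - α) / 2) ^ d) * qs k ^ s := by
                rw [hD, ← rpow_prod, div_pow, div_pow, one_pow, pow_succ]; field_simp
            _ ≤ _ := by gcongr
      _ = ∑ b : Fin (gridN (1 - α) k) × (Fin d → Fin (gridN (β - α) k)),
          ENNReal.ofReal (qs k ^ s) := by
          rw [Finset.sum_const, Finset.card_univ, card_fiber, nsmul_eq_mul,
            ← ENNReal.ofReal_natCast, ← ENNReal.ofReal_mul (by positivity)]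
          push_cast; rfl
      _ ≤ _ := by
          refine Finset.sum_le_sum fun b _ => ENNReal.ofReal_le_ofReal ?_
          exact Real.rpow_le_rpow hq.le (tv_ge (⟨k, b⟩ : Idx d α β)) hs0
  refine top_le_iff.1 (le_trans (le_of_eq ?_) (ENNReal.tsum_le_tsum hb))
  rw [ENNReal.tsum_const_eq_top_of_ne_zero]
  simp

/-- **Example (sharpness of Theorem 5.2): for `0 < β ≤ 1 ≤ α` and `w ∈ S^{n-1}` (n ≥ 2) there is
a discrete, `α`-separated, `β`-well-approximated `E ⊆ 𝔻ⁿ` with `L(E) = {w}` (so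
`upper box dim L(E) = 0`) and `δ(E) = nα − (n−1)β − 1`.** -/
theorem exists_alphaSep_betaWA_singleton_limitSet {n : ℕ} (hn : 2 ≤ n) (α β : ℝ)
    (hβ : 0 < β) (hβ1 : β ≤ 1) (hα : 1 ≤ α)
    (w : Pt n) (hw : w ∈ sphere (0 : Pt n) 1) :
    ∃ E : Set (Pt n), E ⊆ ball 0 1 ∧ IsDiscreteSet E ∧
      AlphaSeparated E α ∧ BetaWellApproximated E β ∧
      limitSet E = {w} ∧ upperBoxDim (limitSet E) = 0 ∧
      critExp E = ENNReal.ofReal (n * α - (n - 1) * β - 1) := by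
  obtain ⟨d, rfl⟩ : ∃ d, n = d + 1 := ⟨n - 1, by omega⟩
  have hw1 : ‖w‖ = 1 := by simpa using hw
  obtain ⟨e, he, hew⟩ := exists_frame w hw1
  let p : Idx d α β → Pt (d + 1) := pp w e
  have hnorm : ∀ i, 1 - ‖p i‖ = tv i := fun i => by
    have := norm_pp hw1 hβ he hew i
    change 1 - ‖pp w e i‖ = _
    linarith
  have hsep : ∀ i i' : Idx d α β, i ≠ i' → qs i.1 ^ α / (2 * (d + 1)) ≤ dist (p i) (p i') :=
    fun i i' h => sep_pp hw1 hβ hα he hew i i' h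
  have hinj : Function.Injective p := by
    intro i i' h
    by_contra hne
    have h1 := hsep i i' hne
    rw [h, dist_self] at h1
    have : 0 < qs i.1 ^ α / (2 * (d + 1)) :=
      div_pos (Real.rpow_pos_of_pos (qs_pos _) _) (by positivity)
    linarith
  have hdist : ∀ i, dist (p i) w ≤ 4 * qs i.1 ^ β := fun i => dist_pp_w hw1 hβ hβ1 he i
  have hlim0 : Tendsto (fun k => 4 * qs k ^ β) atTop (nhds 0) := by
    have := (qs_tendsto.rpow_const (p := β) (Or.inr hβ.le)).const_mul 4
    simpa [Real.zero_rpow hβ.ne'] using this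
  have hsub : range p ⊆ ball 0 1 := by
    rintro _ ⟨i, rfl⟩
    have := hnorm i
    have := tv_pos i
    simp only [mem_ball, dist_zero_right]
    linarith
  have hasep : AlphaSeparated (range p) α := by
    refine ⟨1 / (2 ^ α * (4 * (d + 1))), by positivity, ?_⟩
    rintro _ ⟨i, rfl⟩
    have hq := qs_pos i.1
    have ht := tv_pos i
    ext y
    constructor
    · rintro ⟨hy, i', rfl⟩
      by_contra hne
      have h1 := hsep i i' (fun h => hne (by rw [h]; rfl))
      rw [mem_closedBall, dist_comm, hnorm] at hy
      have h2 : tv i ^ α ≤ 2 ^ α * qs i.1 ^ α := by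
        rw [← Real.mul_rpow (by norm_num) hq.le]
        exact Real.rpow_le_rpow ht.le (tv_le i) (by linarith)
      have h3 : 1 / (2 ^ α * (4 * (d + 1))) * tv i ^ α ≤ qs i.1 ^ α / (2 * (d + 1)) / 2 := by
        calc 1 / (2 ^ α * (4 * (d + 1))) * tv i ^ α
            ≤ 1 / (2 ^ α * (4 * (d + 1))) * (2 ^ α * qs i.1 ^ α) := by gcongr
          _ = qs i.1 ^ α / (2 * (d + 1)) / 2 := by field_simp; norm_num
      have : 0 < qs i.1 ^ α / (2 * (d + 1)) :=
        div_pos (Real.rpow_pos_of_pos (qs_pos _) _) (by positivity)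
      linarith
    · rintro rfl
      refine ⟨mem_closedBall_self ?_, i, rfl⟩
      rw [hnorm]
      positivity
  have hwE : w ∉ range p := fun h => by
    have := hsub h
    simp [hw1] at this
  have hL : limitSet (range p) = {w} := by
    apply Subset.antisymm
    · rintro x ⟨hx, hxE⟩
      by_contra hne
      have hne' : x ≠ w := hne
      have hpos : 0 < dist x w := dist_pos.2 hne'
      obtain ⟨K, hK⟩ := eventually_atTop.1 (hlim0.eventually_lt_const (half_pos hpos))
      have hfin : {i : Idx d α β | i.1 < K}.Finite := by
        have : {i : Idx d α β | i.1 < K} ⊆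
            ⋃ k ∈ Finset.range K, range (fun b => (⟨k, b⟩ : Idx d α β)) := by
          rintro ⟨k, b⟩ hk
          simp only [mem_iUnion]
          exact ⟨k, Finset.mem_range.2 hk, b, rfl⟩
        exact ((Finset.range K).finite_toSet.biUnion fun k _ => finite_range _).subset this
      have hcov : range p ⊆ closedBall w (dist x w / 2) ∪ p '' {i | i.1 < K} := by
        rintro _ ⟨i, rfl⟩
        by_cases hi : i.1 < K
        · exact Or.inr ⟨i, hi, rfl⟩
        · exact Or.inl ((hdist i).trans (hK _ (not_lt.1 hi)).le)
      have hcl := closure_minimal hcov (isClosed_closedBall.union (hfin.image p).isClosed)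
      rcases hcl hx with h | ⟨i, _, h⟩
      · rw [mem_closedBall] at h; linarith
      · exact hxE ⟨i, h⟩
    · rintro _ rfl
      refine ⟨Metric.mem_closure_iff.2 fun ε hε => ?_, hwE⟩
      obtain ⟨K, hK⟩ := eventually_atTop.1 (hlim0.eventually_lt_const hε)
      have hA : 0 < gridN (1 - α) K := by
        have := gridN_pos K (show 1 - α ≤ 0 by linarith)
        exact_mod_cast this
      have hB : 0 < gridN (β - α) K := by
        have := gridN_pos K (show β - α ≤ 0 by linarith)
        exact_mod_cast this
      let i : Idx d α β := ⟨K, ⟨0, hA⟩, fun _ => ⟨0, hB⟩⟩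
      refine ⟨p i, ⟨i, rfl⟩, ?_⟩
      rw [dist_comm]
      exact (hdist i).trans_lt (hK K le_rfl)
  have hacc : ∀ s : ℝ, accSeries (range p) s = ∑' i : Idx d α β, ENNReal.ofReal (tv i ^ s) := by
    intro s
    unfold accSeries
    rw [tsum_range (f := fun x : Pt (d + 1) => ENNReal.ofReal ((1 - ‖x‖) ^ s)) hinj]
    simp only [hnorm]
  refine ⟨range p, hsub, ?_, hasep, ?_, hL, ?_, ?_⟩
  · obtain ⟨c, hc, h⟩ := hasep
    intro x hx
    refine ⟨_, ?_, h x hx⟩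
    have := hsub hx
    simp only [mem_ball, dist_zero_right] at this
    have : 0 < 1 - ‖x‖ := by linarith
    positivity
  · refine ⟨4, by norm_num, ?_⟩
    rintro _ ⟨i, rfl⟩
    refine ⟨w, by rw [hL]; rfl, (hdist i).trans ?_⟩
    rw [hnorm]
    gcongr
    · exact (qs_pos _).le
    · exact tv_ge i
  · rw [hL]; exact upperBoxDim_singleton w
  · have hD : ((d + 1 : ℕ) : ℝ) * α - (((d + 1 : ℕ) : ℝ) - 1) * β - 1
        = (d + 1) * α - d * β - 1 := by push_cast; ring
    rw [hD]
    have hD0 : 0 ≤ (d + 1) * α - d * β - 1 := by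
      have : (0 : ℝ) ≤ d * (α - β) := mul_nonneg (by positivity) (by linarith)
      linarith
    unfold critExp
    apply le_antisymm
    · refine le_of_forall_gt_imp_ge_of_dense fun a ha => ?_
      obtain ⟨s, hs1, hs2⟩ := ENNReal.lt_iff_exists_nnreal_btwn.1 ha
      refine le_trans (iInf₂_le s ?_) hs2.le
      rw [hacc]
      apply series_finite s.2
      rw [← ENNReal.ofReal_coe_nnreal] at hs1
      exact (ENNReal.ofReal_lt_ofReal_iff_of_nonneg hD0).1 hs1
    · refine le_iInf₂ fun s hs => ?_
      rw [hacc] at hs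
      by_contra hlt
      rw [not_le, ← ENNReal.ofReal_coe_nnreal] at hlt
      replace hlt := (ENNReal.ofReal_lt_ofReal_iff_of_nonneg s.2).1 hlt
      exact hs.ne (series_infinite (by linarith) hα s.2 hlt.le)

end
end

section
/- Let 0 < t ≤ γ ≤ 1. There exists a discrete set E ⊆ 𝔻² with critical exponent δ(E) = t whose γ-radial limit set L_rad^γ(E) has Hausdorff dimension exactly t/γ = δ(E)/γ. (Such E is obtained by placing, for each k, one point at distance 2^{-k/t} from the boundary near each of the 2^k level-k cylinders of a self-similar subset X of the circle S¹ generated by two similarities of ratio 2^{-γ/t} satisfying the open set condition; then L_rad^γ(E) = X and dim_H X = t/γ.) Hence the bound dim_H L_rad^γ(E) ≤ δ(E)/γ is sharp. -/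
open Metric Set Filter
open scoped ENNReal NNReal

noncomputable section

lemma cf_nonneg {c : ℝ} (h : 0 ≤ c) (a : ℕ → Bool) : 0 ≤ Cardinal.cantorFunction c a :=
  tsum_nonneg fun _ => Cardinal.cantorFunctionAux_nonneg h

lemma cf_le_inv {c : ℝ} (h : 0 ≤ c) (h1 : c < 1) (a : ℕ → Bool) :
    Cardinal.cantorFunction c a ≤ (1 - c)⁻¹ := by
  rw [← tsum_geometric_of_lt_one h h1]
  refine (Cardinal.summable_cantor_function a h h1).tsum_le_tsum ?_
    (summable_geometric_of_lt_one h h1)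
  intro n
  cases h' : a n
  · simpa [h'] using pow_nonneg h n
  · simp [h']

lemma cf_le_two {c : ℝ} (h : 0 ≤ c) (h1 : c ≤ 1 / 2) (a : ℕ → Bool) :
    Cardinal.cantorFunction c a ≤ 2 := by
  refine (cf_le_inv h (by linarith) a).trans ?_
  rw [inv_le_comm₀ (by linarith) (by norm_num)]
  linarith

lemma cf_agree {c : ℝ} (h : 0 ≤ c) (h1 : c ≤ 1 / 2) (k : ℕ) : ∀ a b : ℕ → Bool,
    (∀ i < k, a i = b i) →
    |Cardinal.cantorFunction c a - Cardinal.cantorFunction c b| ≤ 2 * c ^ k := by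
  induction k with
  | zero =>
    intro a b _
    have := cf_nonneg h a
    have := cf_nonneg h b
    have := cf_le_two h h1 a
    have := cf_le_two h h1 b
    rw [abs_le]
    constructor <;> simp <;> linarith
  | succ k ih =>
    intro a b hab
    rw [Cardinal.cantorFunction_succ a h (by linarith),
      Cardinal.cantorFunction_succ b h (by linarith), hab 0 (by omega),
      add_sub_add_left_eq_sub, ← mul_sub, abs_mul, abs_of_nonneg h]
    have := ih (fun n => a (n + 1)) (fun n => b (n + 1)) (fun i hi => hab (i + 1) (by omega))
    calc _ ≤ c * (2 * c ^ k) := by gcongr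
      _ = _ := by ring

lemma cf_sep {c : ℝ} (h : 0 ≤ c) (h1 : c < 1 / 2) (k : ℕ) : ∀ a b : ℕ → Bool,
    (∀ i < k, a i = b i) → a k ≠ b k →
    c ^ k * (1 - 2 * c) ≤ |Cardinal.cantorFunction c a - Cardinal.cantorFunction c b| := by
  induction k with
  | zero =>
    intro a b _ hne
    rw [Cardinal.cantorFunction_succ a h (by linarith),
      Cardinal.cantorFunction_succ b h (by linarith)]
    have ha := mul_nonneg h (cf_nonneg h fun n => a (n + 1))
    have hb := mul_nonneg h (cf_nonneg h fun n => b (n + 1))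
    have ha' := mul_le_mul_of_nonneg_left (cf_le_two h h1.le fun n => a (n + 1)) h
    have hb' := mul_le_mul_of_nonneg_left (cf_le_two h h1.le fun n => b (n + 1)) h
    cases h2 : a 0 <;> cases h3 : b 0 <;> simp only [h2, h3, cond_true, cond_false, pow_zero, one_mul, zero_add, ne_eq, not_true_eq_false] at hne ⊢
    · rw [abs_sub_comm]
      refine le_trans ?_ (le_abs_self _)
      linarith
    · refine le_trans ?_ (le_abs_self _)
      linarith
  | succ k ih =>
    intro a b hab hne
    rw [Cardinal.cantorFunction_succ a h (by linarith),
      Cardinal.cantorFunction_succ b h (by linarith), hab 0 (by omega),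
      add_sub_add_left_eq_sub, ← mul_sub, abs_mul, abs_of_nonneg h]
    have := ih (fun n => a (n + 1)) (fun n => b (n + 1)) (fun i hi => hab (i + 1) (by omega)) hne
    calc _ = c * (c ^ k * (1 - 2 * c)) := by ring
      _ ≤ _ := by gcongr

/-- Hölder estimate for the Cantor function. -/
lemma cf_holder {c s : ℝ} (h : 0 < c) (h1 : c ≤ 1 / 2) (hs : 0 < s) (hcs : c ^ s = 1 / 2) :
    ∃ C : ℝ, 0 ≤ C ∧ ∀ a b : ℕ → Bool,
      |Cardinal.cantorFunction (1 / 2) a - Cardinal.cantorFunction (1 / 2) b| ≤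
        C * |Cardinal.cantorFunction c a - Cardinal.cantorFunction c b| ^ s := by
  rcases h1.lt_or_eq with h1 | h1
  · have hp : 0 < 1 - 2 * c := by linarith
    refine ⟨2 * ((1 - 2 * c) ^ s)⁻¹, by positivity, fun a b => ?_⟩
    by_cases hab : a = b
    · subst hab
      simp [Real.zero_rpow hs.ne']
    have hex : ∃ n, a n ≠ b n := Function.ne_iff.mp hab
    classical
    have hk := Nat.find_spec hex
    have hlt : ∀ i < Nat.find hex, a i = b i := fun i hi => by
      simpa using Nat.find_min hex hi
    set k := Nat.find hex
    have e1 := cf_agree (c := 1 / 2) (by norm_num) le_rfl k a b hlt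
    have e2 := cf_sep h.le h1 k a b hlt hk
    have e3 := Real.rpow_le_rpow (by positivity) e2 hs.le
    rw [Real.mul_rpow (by positivity) hp.le, ← Real.rpow_natCast, ← Real.rpow_mul h.le,
      mul_comm (k : ℝ) s, Real.rpow_mul h.le, hcs, Real.rpow_natCast] at e3
    have hq : 0 < (1 - 2 * c) ^ s := by positivity
    rw [← le_div_iff₀ hq] at e3
    calc _ ≤ 2 * (1 / 2) ^ k := e1
      _ ≤ 2 * (_ / (1 - 2 * c) ^ s) := by gcongr
      _ = _ := by rw [div_eq_mul_inv]; ring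
  · subst h1
    have : s = 1 := by
      have h2 : ((1 : ℝ) / 2) ^ s = (1 / 2) ^ (1 : ℝ) := by rw [hcs]; simp
      exact (Real.rpow_right_inj (by norm_num) (by norm_num)).1 h2
    subst this
    exact ⟨1, by norm_num, fun a b => by simp⟩

lemma cf_half_lt (k : ℕ) : ∀ a : ℕ → Bool, (∀ i ≥ k, a i = false) →
    Cardinal.cantorFunction (1 / 2) a < 2 := by
  induction k with
  | zero =>
    intro a ha
    have : Cardinal.cantorFunction (1 / 2) a = 0 := by
      simp [Cardinal.cantorFunction, Cardinal.cantorFunctionAux, ha]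
    rw [this]; norm_num
  | succ k ih =>
    intro a ha
    have := ih (fun n => a (n + 1)) (fun i hi => ha _ (by omega))
    rw [Cardinal.cantorFunction_succ a (by norm_num) (by norm_num)]
    cases a 0 <;> simp only [cond_true, cond_false] <;> linarith

lemma cf_half_inj (k : ℕ) : ∀ a b : ℕ → Bool, (∀ i ≥ k, a i = false) → (∀ i ≥ k, b i = false) →
    Cardinal.cantorFunction (1 / 2) a = Cardinal.cantorFunction (1 / 2) b → a = b := by
  induction k with
  | zero =>
    intro a b ha hb _
    funext i
    rw [ha i (by omega), hb i (by omega)]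
  | succ k ih =>
    intro a b ha hb hab
    have h1 : ∀ i ≥ k, a (i + 1) = false := fun i hi => ha _ (by omega)
    have h2 : ∀ i ≥ k, b (i + 1) = false := fun i hi => hb _ (by omega)
    have l1 := cf_half_lt k (fun n => a (n + 1)) h1
    have l2 := cf_half_lt k (fun n => b (n + 1)) h2
    have n1 := cf_nonneg (c := 1 / 2) (by norm_num) (fun n => a (n + 1))
    have n2 := cf_nonneg (c := 1 / 2) (by norm_num) (fun n => b (n + 1))
    have i1 := ih (fun n => a (n + 1)) (fun n => b (n + 1)) h1 h2
    rw [Cardinal.cantorFunction_succ a (by norm_num) (by norm_num),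
      Cardinal.cantorFunction_succ b (by norm_num) (by norm_num)] at hab
    have key : a 0 = b 0 := by
      cases h3 : a 0 <;> cases h4 : b 0 <;> simp only [h3, h4, cond_true, cond_false] at hab ⊢ <;>
        linarith
    rw [key] at hab
    have := i1 (by linarith)
    funext i
    cases i with
    | zero => exact key
    | succ i => exact congrFun this i

lemma cf_half_surj (x : ℝ) (hx : x ∈ Icc (0 : ℝ) 1) :
    ∃ a, Cardinal.cantorFunction (1 / 2) a = 2 * x := by
  obtain ⟨d, -, hd⟩ := Real.ofDigits_SurjOn (b := 2) (by norm_num) hx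
  refine ⟨fun i => decide (d i = 1), ?_⟩
  rw [← hd, Real.ofDigits, ← tsum_mul_left, Cardinal.cantorFunction]
  refine tsum_congr fun n => ?_
  rw [Real.ofDigitsTerm, Cardinal.cantorFunctionAux]
  have : d n = 0 ∨ d n = 1 := by omega
  rcases this with h | h <;> simp [h, pow_succ]

/-- Parametrisation of an arc of the unit circle by the second coordinate. -/
def arcPt (y : ℝ) : Pt 2 := !₂[Real.sqrt (1 - y ^ 2), y]

lemma norm_arcPt {y : ℝ} (h0 : 0 ≤ y) (h1 : y ≤ 1 / 2) : ‖arcPt y‖ = 1 := by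
  rw [EuclideanSpace.norm_eq, Fin.sum_univ_two]
  have : 0 ≤ 1 - y ^ 2 := by nlinarith
  simp [arcPt, Real.sq_sqrt this]

lemma le_dist_arcPt (x y : ℝ) : |x - y| ≤ dist (arcPt x) (arcPt y) := by
  rw [EuclideanSpace.dist_eq, Fin.sum_univ_two]
  apply Real.le_sqrt_of_sq_le
  simp [arcPt, Real.dist_eq, sq_nonneg]

lemma dist_arcPt_le {x y : ℝ} (hx0 : 0 ≤ x) (hx1 : x ≤ 1 / 2) (hy0 : 0 ≤ y) (hy1 : y ≤ 1 / 2) :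
    dist (arcPt x) (arcPt y) ≤ 2 * |x - y| := by
  have hx : (1 / 4 : ℝ) ≤ 1 - x ^ 2 := by nlinarith
  have hy : (1 / 4 : ℝ) ≤ 1 - y ^ 2 := by nlinarith
  have sx : (1 / 2 : ℝ) ≤ √(1 - x ^ 2) := Real.le_sqrt_of_sq_le (by linarith)
  have sy : (1 / 2 : ℝ) ≤ √(1 - y ^ 2) := Real.le_sqrt_of_sq_le (by linarith)
  have qx : √(1 - x ^ 2) ^ 2 = 1 - x ^ 2 := Real.sq_sqrt (by linarith)
  have qy : √(1 - y ^ 2) ^ 2 = 1 - y ^ 2 := Real.sq_sqrt (by linarith)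
  have key : |√(1 - x ^ 2) - √(1 - y ^ 2)| ≤ |x - y| := by
    have e : (√(1 - x ^ 2) - √(1 - y ^ 2)) * (√(1 - x ^ 2) + √(1 - y ^ 2)) = (y - x) * (x + y) := by
      nlinarith
    have e2 := congrArg abs e
    rw [abs_mul, abs_mul, abs_of_nonneg (by linarith : 0 ≤ √(1 - x ^ 2) + √(1 - y ^ 2)),
      abs_of_nonneg (by linarith : 0 ≤ x + y), abs_sub_comm y x] at e2
    have a1 := abs_nonneg (√(1 - x ^ 2) - √(1 - y ^ 2))
    have a2 := abs_nonneg (x - y)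
    nlinarith
  rw [EuclideanSpace.dist_eq, Fin.sum_univ_two]
  apply Real.sqrt_le_iff.2 ⟨by positivity, ?_⟩
  have k2 := pow_le_pow_left₀ (abs_nonneg _) key 2
  simp only [arcPt, Real.dist_eq]
  simp
  simp only [sq_abs] at k2
  rw [mul_pow, sq_abs]
  nlinarith [sq_nonneg (x - y)]

/-- Extend a finite word by `false`. -/
def extWord {k : ℕ} (w : Fin k → Bool) : ℕ → Bool := fun i => if h : i < k then w ⟨i, h⟩ else false

lemma extWord_tail {k : ℕ} (w : Fin k → Bool) : ∀ i ≥ k, extWord w i = false := by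
  intro i hi
  simp [extWord, not_lt.2 hi]

lemma extWord_inj {k : ℕ} : Function.Injective (extWord (k := k)) := by
  intro w v h
  funext i
  have := congrFun h i
  simpa [extWord] using this

lemma extWord_trunc (a : ℕ → Bool) (k : ℕ) :
    ∀ i < k, extWord (fun j : Fin k => a j) i = a i := by
  intro i hi
  simp [extWord, hi]

/-- The arc point with address `a`. -/
def cantorPt (c : ℝ) (a : ℕ → Bool) : Pt 2 := arcPt (Cardinal.cantorFunction c a / 4)

/-- The points of the set `E`. -/
def ePt (η c : ℝ) (p : Σ k : ℕ, (Fin k → Bool)) : Pt 2 :=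
  (1 - η ^ p.1) • cantorPt c (extWord p.2)

lemma norm_cantorPt {c : ℝ} (h : 0 ≤ c) (h1 : c ≤ 1 / 2) (a : ℕ → Bool) : ‖cantorPt c a‖ = 1 := by
  have := cf_nonneg h a
  have := cf_le_two h h1 a
  exact norm_arcPt (by linarith) (by linarith)

lemma norm_ePt {η c : ℝ} (hη : 0 < η) (hη1 : η < 1) (h : 0 ≤ c) (h1 : c ≤ 1 / 2)
    (p : Σ k : ℕ, (Fin k → Bool)) : ‖ePt η c p‖ = 1 - η ^ p.1 := by
  have : η ^ p.1 ≤ 1 := pow_le_one₀ hη.le hη1.le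
  rw [ePt, norm_smul, norm_cantorPt h h1, mul_one, Real.norm_of_nonneg (by linarith)]

lemma dist_cantorPt_agree {c : ℝ} (h : 0 ≤ c) (h1 : c ≤ 1 / 2) (k : ℕ) (a b : ℕ → Bool)
    (hab : ∀ i < k, a i = b i) : dist (cantorPt c a) (cantorPt c b) ≤ c ^ k := by
  have := cf_nonneg h a
  have := cf_le_two h h1 a
  have := cf_nonneg h b
  have := cf_le_two h h1 b
  refine (dist_arcPt_le (by linarith) (by linarith) (by linarith) (by linarith)).trans ?_
  rw [← sub_div, abs_div, abs_of_nonneg (by norm_num : (0 : ℝ) ≤ 4)]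
  linarith [cf_agree h h1 k a b hab]

lemma cantorPt_holder {c s : ℝ} (h : 0 < c) (h1 : c ≤ 1 / 2) (hs : 0 < s) (hcs : c ^ s = 1 / 2) :
    ∃ C : ℝ, 0 ≤ C ∧ ∀ a b : ℕ → Bool,
      |Cardinal.cantorFunction (1 / 2) a - Cardinal.cantorFunction (1 / 2) b| ≤
        C * dist (cantorPt c a) (cantorPt c b) ^ s := by
  obtain ⟨C, hC, H⟩ := cf_holder h h1 hs hcs
  refine ⟨C * 4 ^ s, by positivity, fun a b => (H a b).trans ?_⟩
  have := le_dist_arcPt (Cardinal.cantorFunction c a / 4) (Cardinal.cantorFunction c b / 4)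
  rw [← sub_div, abs_div, abs_of_nonneg (by norm_num : (0 : ℝ) ≤ 4), div_le_iff₀ (by norm_num)]
    at this
  rw [mul_assoc, ← Real.mul_rpow (by norm_num) dist_nonneg]
  gcongr
  rw [mul_comm]
  exact this

lemma ePt_inj {η c s : ℝ} (hη : 0 < η) (hη1 : η < 1) (h : 0 < c) (h1 : c ≤ 1 / 2) (hs : 0 < s)
    (hcs : c ^ s = 1 / 2) : Function.Injective (ePt η c) := by
  rintro ⟨k, w⟩ ⟨m, v⟩ hp
  have hn := congrArg norm hp
  rw [norm_ePt hη hη1 h.le h1, norm_ePt hη hη1 h.le h1] at hn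
  have hkm : k = m := pow_right_injective₀ hη hη1.ne (by simpa using hn)
  subst hkm
  congr 1
  rcases Nat.eq_zero_or_pos k with rfl | hk
  · exact Subsingleton.elim _ _
  have hlt : η ^ k < 1 := pow_lt_one₀ hη.le hη1 hk.ne'
  have hc : cantorPt c (extWord w) = cantorPt c (extWord v) := by
    simp only [ePt] at hp
    exact smul_right_injective _ (by linarith : 1 - η ^ k ≠ 0) hp
  obtain ⟨C, hC, H⟩ := cantorPt_holder h h1 hs hcs
  have e := H (extWord w) (extWord v)
  rw [hc, dist_self, Real.zero_rpow hs.ne', mul_zero] at e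
  have e' := sub_eq_zero.1 (abs_nonpos_iff.1 e)
  exact extWord_inj (cf_half_inj k _ _ (extWord_tail w) (extWord_tail v) e')

lemma ePt_finite {η c : ℝ} (hη : 0 < η) (hη1 : η < 1) (h : 0 ≤ c) (h1 : c ≤ 1 / 2) {R : ℝ}
    (hR : R < 1) : (range (ePt η c) ∩ ball 0 R).Finite := by
  obtain ⟨n, hn⟩ := exists_pow_lt_of_lt_one (by linarith : 0 < 1 - R) hη1
  have : range (ePt η c) ∩ ball 0 R ⊆
      ⋃ k ∈ Finset.range n, range (fun w : Fin k → Bool => ePt η c ⟨k, w⟩) := by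
    rintro _ ⟨⟨⟨k, w⟩, rfl⟩, hx⟩
    rw [mem_ball_zero_iff, norm_ePt hη hη1 h h1] at hx
    simp only [mem_iUnion, Finset.mem_range]
    refine ⟨k, ?_, w, rfl⟩
    by_contra hk
    have := pow_le_pow_of_le_one hη.le hη1.le (not_lt.1 hk)
    simp only at hx
    linarith
  refine Finite.subset ?_ this
  exact Finite.biUnion (Finset.finite_toSet _) fun k _ => finite_range _

lemma ePt_ball {η c : ℝ} (hη : 0 < η) (hη1 : η < 1) (h : 0 ≤ c) (h1 : c ≤ 1 / 2) :
    range (ePt η c) ⊆ ball 0 1 := by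
  rintro _ ⟨p, rfl⟩
  rw [mem_ball_zero_iff, norm_ePt hη hη1 h h1]
  have := pow_pos hη p.1
  linarith

lemma ePt_discrete {η c : ℝ} (hη : 0 < η) (hη1 : η < 1) (h : 0 ≤ c) (h1 : c ≤ 1 / 2) :
    IsDiscreteSet (range (ePt η c)) := by
  intro x hx
  have hx1 := mem_ball_zero_iff.1 (ePt_ball hη hη1 h h1 hx)
  have hfin := ePt_finite hη hη1 h h1 (R := (1 + ‖x‖) / 2) (by linarith)
  have hfin2 := hfin.subset (sdiff_subset (t := {x}))
  have h2 : (((range (ePt η c) ∩ ball 0 ((1 + ‖x‖) / 2)) \ {x})ᶜ ∩ ball 0 ((1 + ‖x‖) / 2)) ∈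
      nhds x := by
    refine Filter.inter_mem (hfin2.isClosed.isOpen_compl.mem_nhds (by simp))
      (isOpen_ball.mem_nhds ?_)
    rw [mem_ball_zero_iff]; linarith
  obtain ⟨r, hr, hs⟩ := Metric.nhds_basis_closedBall.mem_iff.1 h2
  refine ⟨r, hr, Subset.antisymm ?_ ?_⟩
  · rintro y ⟨hy, hyE⟩
    obtain ⟨hy1, hy2⟩ := hs hy
    by_contra hne
    exact hy1 ⟨⟨hyE, hy2⟩, hne⟩
  · rintro y rfl
    exact ⟨mem_closedBall_self hr.le, hx⟩

lemma accSeries_ePt {η c s : ℝ} (hη : 0 < η) (hη1 : η < 1) (h : 0 < c) (h1 : c ≤ 1 / 2) (hs : 0 < s)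
    (hcs : c ^ s = 1 / 2) (u : ℝ) :
    accSeries (range (ePt η c)) u = ∑' k : ℕ, (2 * ENNReal.ofReal (η ^ u)) ^ k := by
  unfold accSeries
  rw [← (Equiv.ofInjective _ (ePt_inj hη hη1 h h1 hs hcs)).tsum_eq, ENNReal.tsum_sigma']
  refine tsum_congr fun k => ?_
  simp only [Equiv.ofInjective_apply, norm_ePt hη hη1 h.le h1, sub_sub_cancel]
  rw [tsum_fintype, Finset.sum_const, Finset.card_univ, Fintype.card_fun, Fintype.card_bool,
    Fintype.card_fin, nsmul_eq_mul, mul_pow, ← ENNReal.ofReal_pow (by positivity),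
    ← Real.rpow_natCast, ← Real.rpow_mul hη.le, mul_comm (k : ℝ), Real.rpow_mul hη.le,
    Real.rpow_natCast]
  simp

lemma critExp_ePt {η c s t : ℝ} (hη : 0 < η) (hη1 : η < 1) (h : 0 < c) (h1 : c ≤ 1 / 2) (hs : 0 < s)
    (hcs : c ^ s = 1 / 2) (ht : 0 < t) (hηt : η ^ t = 1 / 2) :
    critExp (range (ePt η c)) = ENNReal.ofReal t := by
  have hhalf : ENNReal.ofReal (1 / 2) = 2⁻¹ := by
    rw [one_div, ENNReal.ofReal_inv_of_pos (by norm_num)]; simp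
  apply le_antisymm
  · refine le_of_forall_gt fun u hu => ?_
    obtain ⟨v, hv1, hv2⟩ := ENNReal.lt_iff_exists_nnreal_btwn.1 hu
    refine lt_of_le_of_lt ?_ hv2
    refine iInf₂_le v ?_
    rw [accSeries_ePt hη hη1 h h1 hs hcs, ENNReal.tsum_geometric, ENNReal.inv_lt_top,
      tsub_pos_iff_lt]
    have : t < v := by
      have := (ENNReal.ofReal_lt_iff_lt_toReal ht.le ENNReal.coe_ne_top).1 hv1
      simpa using this
    have h3 : η ^ (v : ℝ) < 1 / 2 := by
      rw [← hηt]; exact Real.rpow_lt_rpow_of_exponent_gt hη hη1 this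
    have h4 : ENNReal.ofReal (η ^ (v : ℝ)) < 2⁻¹ := by
      rw [← hhalf]; exact (ENNReal.ofReal_lt_ofReal_iff (by norm_num)).2 h3
    calc 2 * ENNReal.ofReal (η ^ (v : ℝ)) < 2 * 2⁻¹ :=
          ENNReal.mul_lt_mul_right (by norm_num) (by norm_num) h4
      _ = 1 := ENNReal.mul_inv_cancel (by norm_num) (by norm_num)
  · refine le_iInf₂ fun v hv => ?_
    by_contra hlt
    rw [not_le] at hlt
    have hvt : (v : ℝ) < t := by
      have := (ENNReal.lt_ofReal_iff_toReal_lt ENNReal.coe_ne_top).1 hlt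
      simpa using this
    rw [accSeries_ePt hη hη1 h h1 hs hcs, ENNReal.tsum_geometric, ENNReal.inv_lt_top,
      tsub_pos_iff_lt] at hv
    refine absurd hv (not_lt.2 ?_)
    have h3 : 1 / 2 ≤ η ^ (v : ℝ) := by
      rw [← hηt]; exact Real.rpow_le_rpow_of_exponent_ge hη hη1.le hvt.le
    calc (1 : ℝ≥0∞) = 2 * 2⁻¹ := (ENNReal.mul_inv_cancel (by norm_num) (by norm_num)).symm
      _ ≤ _ := by
        rw [← hhalf]
        gcongr

/-- The Cantor set lies in the `γ`-radial limit set. -/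
lemma cantorPt_mem {η γ : ℝ} (hη : 0 < η) (hη1 : η < 1) (hγ : 0 < γ) (hγ1 : γ ≤ 1)
    (h1 : η ^ γ ≤ 1 / 2) (a : ℕ → Bool) :
    cantorPt (η ^ γ) a ∈ gammaRadialLimitSet (range (ePt η (η ^ γ))) γ := by
  have h : 0 ≤ η ^ γ := by positivity
  set x : ℕ → Pt 2 := fun k => ePt η (η ^ γ) ⟨k, fun j : Fin k => a j⟩ with hxdef
  have hxn : ∀ k, 1 - ‖x k‖ = η ^ k := fun k => by
    rw [hxdef]; simp only; rw [norm_ePt hη hη1 h h1]; ring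
  have hpow : ∀ k : ℕ, (η ^ γ) ^ k = (η ^ k) ^ γ := fun k => by
    rw [← Real.rpow_natCast, ← Real.rpow_natCast, ← Real.rpow_mul hη.le, ← Real.rpow_mul hη.le,
      mul_comm]
  have hd : ∀ k, dist (x k) (cantorPt (η ^ γ) a) ≤ 2 * (η ^ k) ^ γ := fun k => by
    have d1 : dist (x k) (cantorPt (η ^ γ) (extWord (fun j : Fin k => a j))) ≤ η ^ k := by
      rw [hxdef, dist_eq_norm]
      simp only [ePt]
      rw [sub_smul, one_smul, sub_sub_cancel_left, norm_neg, norm_smul, norm_cantorPt h h1,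
        mul_one, Real.norm_of_nonneg (by positivity)]
    have d2 := dist_cantorPt_agree h h1 k _ a (extWord_trunc a k)
    have d3 : η ^ k ≤ (η ^ k) ^ γ := by
      conv_lhs => rw [← Real.rpow_one (η ^ k)]
      exact Real.rpow_le_rpow_of_exponent_ge (by positivity) (pow_le_one₀ hη.le hη1.le) hγ1
    rw [hpow] at d2
    linarith [dist_triangle (x k) (cantorPt (η ^ γ) (extWord (fun j : Fin k => a j)))
      (cantorPt (η ^ γ) a)]
  refine mem_iUnion₂.2 ⟨2, by norm_num, ⟨?_, ?_⟩, ?_⟩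
  · rw [Metric.mem_closure_iff]
    intro ε hε
    obtain ⟨n, hn⟩ := exists_pow_lt_of_lt_one (by positivity : 0 < ε / 2)
      (by linarith : η ^ γ < 1)
    refine ⟨x n, mem_range_self _, ?_⟩
    rw [dist_comm]
    have := hd n
    rw [← hpow] at this
    linarith
  · intro hE
    have := mem_ball_zero_iff.1 (ePt_ball hη hη1 h h1 hE)
    rw [norm_cantorPt h h1] at this
    exact lt_irrefl _ this
  · intro r hr
    obtain ⟨n, hn⟩ := exists_pow_lt_of_lt_one hr hη1
    refine ⟨x n, mem_range_self _, ?_, ?_⟩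
    · rw [hxn]; exact hd n
    · rw [hxn]
      gcongr

lemma le_dimH_gammaRadial {η γ s : ℝ} (hη : 0 < η) (hη1 : η < 1) (hγ : 0 < γ) (hγ1 : γ ≤ 1)
    (h1 : η ^ γ ≤ 1 / 2) (hs : 0 < s) (hcs : (η ^ γ) ^ s = 1 / 2) :
    ENNReal.ofReal s ≤ dimH (gammaRadialLimitSet (range (ePt η (η ^ γ))) γ) := by
  have h : 0 < η ^ γ := by positivity
  obtain ⟨C, hC, H⟩ := cantorPt_holder h h1 hs hcs
  have hsub : range (cantorPt (η ^ γ)) ⊆ gammaRadialLimitSet (range (ePt η (η ^ γ))) γ := by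
    rintro _ ⟨a, rfl⟩
    exact cantorPt_mem hη hη1 hγ hγ1 h1 a
  refine le_trans ?_ (dimH_mono hsub)
  set f : Pt 2 → ℝ := fun z =>
    Cardinal.cantorFunction (1 / 2) (Function.invFun (cantorPt (η ^ γ)) z) with hf
  have hfa : ∀ a, f (cantorPt (η ^ γ) a) = Cardinal.cantorFunction (1 / 2) a := fun a => by
    have e := H (Function.invFun (cantorPt (η ^ γ)) (cantorPt (η ^ γ) a)) a
    rw [Function.invFun_eq (f := cantorPt (η ^ γ)) ⟨a, rfl⟩, dist_self, Real.zero_rpow hs.ne', mul_zero] at e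
    exact sub_eq_zero.1 (abs_nonpos_iff.1 e)
  have hH : HolderOnWith C.toNNReal s.toNNReal f (range (cantorPt (η ^ γ))) := by
    rintro _ ⟨a, rfl⟩ _ ⟨b, rfl⟩
    rw [hfa, hfa, edist_dist, edist_dist, Real.dist_eq, Real.coe_toNNReal _ hs.le,
      ENNReal.ofReal_rpow_of_nonneg dist_nonneg hs.le]
    change _ ≤ ENNReal.ofReal C * _
    rw [← ENNReal.ofReal_mul hC]
    exact ENNReal.ofReal_le_ofReal (H a b)
  have hd := hH.dimH_image_le (by simpa using hs)
  have himg : Icc (0 : ℝ) 2 ⊆ f '' range (cantorPt (η ^ γ)) := by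
    intro x hx
    obtain ⟨a, ha⟩ := cf_half_surj (x / 2) ⟨by linarith [hx.1], by linarith [hx.2]⟩
    exact ⟨_, ⟨a, rfl⟩, by rw [hfa, ha]; ring⟩
  have h1 : dimH (Icc (0 : ℝ) 2) = 1 := by
    rw [Real.dimH_of_nonempty_interior (by rw [interior_Icc]; exact nonempty_Ioo.2 (by norm_num))]
    simp
  have h2 := (dimH_mono himg).trans hd
  rw [h1] at h2
  have hs0 : (s.toNNReal : ℝ≥0∞) ≠ 0 := by simpa using hs
  rw [ENNReal.le_div_iff_mul_le (Or.inl hs0) (Or.inl ENNReal.coe_ne_top), one_mul] at h2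
  exact h2

lemma hausdorff_gammaRadialPoints {η γ s d : ℝ} (hη : 0 < η) (hη1 : η < 1) (hγ : 0 < γ)
    (h1 : η ^ γ ≤ 1 / 2) (hcs : (η ^ γ) ^ s = 1 / 2) (hs : 0 < s) (hd : s < d) {N : ℝ}
    (hN : 1 ≤ N) :
    MeasureTheory.Measure.hausdorffMeasure d
      (gammaRadialPoints (range (ePt η (η ^ γ))) γ N) = 0 := by
  have h : 0 < η ^ γ := by positivity
  have hd0 : 0 < d := hs.trans hd
  have hpow : ∀ k : ℕ, (η ^ k) ^ γ = (η ^ γ) ^ k := fun k => by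
    rw [← Real.rpow_natCast, ← Real.rpow_natCast, ← Real.rpow_mul hη.le, ← Real.rpow_mul hη.le,
      mul_comm]
  set c := η ^ γ with hc
  set U : ∀ n : ℕ, (Σ k : ℕ, (Fin (k + n) → Bool)) → Set (Pt 2) := fun n p =>
    closedBall (ePt η c ⟨p.1 + n, p.2⟩) (N * c ^ (p.1 + n)) with hU
  have hdiam : ∀ n p, ediam (U n p) ≤ ENNReal.ofReal (2 * N) * ENNReal.ofReal c ^ (p.1 + n) := by
    intro n p
    rw [← ENNReal.ofReal_pow h.le, ← ENNReal.ofReal_mul (by linarith)]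
    have : 0 ≤ N * c ^ (p.1 + n) := by positivity
    refine (Metric.ediam_le_of_forall_dist_le (C := 2 * (N * c ^ (p.1 + n))) ?_).trans ?_
    · intro x hx y hy
      have := mem_closedBall.1 hx
      have := mem_closedBall'.1 hy
      linarith [dist_triangle x (ePt η c ⟨p.1 + n, p.2⟩) y]
    · apply ENNReal.ofReal_le_ofReal; linarith
  have hclt : ENNReal.ofReal c < 1 := by
    rw [← ENNReal.ofReal_one]; exact (ENNReal.ofReal_lt_ofReal_iff (by norm_num)).2 (by linarith)
  have key := MeasureTheory.Measure.hausdorffMeasure_le_liminf_tsum d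
    (gammaRadialPoints (range (ePt η c)) γ N) (l := atTop)
    (fun n : ℕ => ENNReal.ofReal (2 * N) * ENNReal.ofReal c ^ n) ?_ U ?_ ?_
  · refine le_antisymm (key.trans ?_) zero_le
    have hq : (2 : ℝ≥0∞) * ENNReal.ofReal c ^ d < 1 := by
      have h3 : c ^ d < 1 / 2 := by
        rw [← hcs]; exact Real.rpow_lt_rpow_of_exponent_gt h (by linarith) hd
      have h4 : ENNReal.ofReal (c ^ d) < ENNReal.ofReal (1 / 2) :=
        (ENNReal.ofReal_lt_ofReal_iff (by norm_num)).2 h3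
      rw [one_div, ENNReal.ofReal_inv_of_pos (by norm_num)] at h4
      rw [ENNReal.ofReal_rpow_of_nonneg h.le hd0.le]
      calc 2 * ENNReal.ofReal (c ^ d) < 2 * 2⁻¹ :=
            ENNReal.mul_lt_mul_right (by norm_num) (by norm_num) (by simpa using h4)
        _ = 1 := ENNReal.mul_inv_cancel (by norm_num) (by norm_num)
    set f : ℕ → ℝ≥0∞ := fun k =>
      ENNReal.ofReal (2 * N) ^ d * (2 * ENNReal.ofReal c ^ d) ^ k with hf
    have hfs : ∑' k, f k ≠ ⊤ := by
      rw [hf, ENNReal.tsum_mul_left, ENNReal.tsum_geometric]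
      refine ENNReal.mul_ne_top (ENNReal.rpow_ne_top_of_nonneg hd0.le ENNReal.ofReal_ne_top) ?_
      rw [ENNReal.inv_ne_top]
      exact (tsub_pos_iff_lt.2 hq).ne'
    have hlim := ENNReal.tendsto_sum_nat_add f hfs
    rw [← hlim.liminf_eq]
    refine liminf_le_liminf (Eventually.of_forall fun n => ?_)
    rw [ENNReal.tsum_sigma']
    refine ENNReal.tsum_le_tsum fun k => ?_
    calc _ ≤ ∑' _ : Fin (k + n) → Bool,
          (ENNReal.ofReal (2 * N) * ENNReal.ofReal c ^ (k + n)) ^ d :=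
          ENNReal.tsum_le_tsum fun w => ENNReal.rpow_le_rpow (hdiam n ⟨k, w⟩) hd0.le
      _ = f (k + n) := by
        rw [tsum_fintype, Finset.sum_const, Finset.card_univ, Fintype.card_fun, Fintype.card_bool,
          Fintype.card_fin, nsmul_eq_mul, ENNReal.mul_rpow_of_nonneg _ _ hd0.le, hf]
        simp only
        rw [mul_pow, ← ENNReal.rpow_natCast, ← ENNReal.rpow_natCast (ENNReal.ofReal c ^ d),
          ← ENNReal.rpow_mul, ← ENNReal.rpow_mul, mul_comm d]
        push_cast
        ring
  · have := (ENNReal.tendsto_pow_atTop_nhds_zero_of_lt_one hclt)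
    simpa using ENNReal.Tendsto.const_mul this (Or.inr (ENNReal.ofReal_ne_top (r := 2 * N)))
  · refine Eventually.of_forall fun n p => (hdiam n p).trans ?_
    gcongr _ * ?_
    exact pow_le_pow_of_le_one zero_le hclt.le (by omega)
  · refine Eventually.of_forall fun n z hz => ?_
    obtain ⟨_, ⟨⟨k, w⟩, rfl⟩, hz1, hz2⟩ := hz.2 (η ^ n) (by positivity)
    rw [norm_ePt hη hη1 h.le h1, sub_sub_cancel] at hz1 hz2
    simp only [hpow] at hz1 hz2
    have hnk : n ≤ k := by
      have := le_of_mul_le_mul_left hz2 (by linarith)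
      exact (pow_le_pow_iff_right_of_lt_one₀ h (by linarith)).1 this
    obtain ⟨m, rfl⟩ := Nat.exists_eq_add_of_le' hnk
    exact mem_iUnion.2 ⟨⟨m, w⟩, mem_closedBall'.2 hz1⟩

lemma dimH_gammaRadial_le {η γ s : ℝ} (hη : 0 < η) (hη1 : η < 1) (hγ : 0 < γ)
    (h1 : η ^ γ ≤ 1 / 2) (hs : 0 < s) (hcs : (η ^ γ) ^ s = 1 / 2) :
    dimH (gammaRadialLimitSet (range (ePt η (η ^ γ))) γ) ≤ ENNReal.ofReal s := by
  have h : 0 < η ^ γ := by positivity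
  have hsub : gammaRadialLimitSet (range (ePt η (η ^ γ))) γ ⊆
      ⋃ n : ℕ, gammaRadialPoints (range (ePt η (η ^ γ))) γ (n + 1) := by
    intro z hz
    obtain ⟨c, hc, hz⟩ := mem_iUnion₂.1 hz
    obtain ⟨n, hn⟩ := exists_nat_ge c
    refine mem_iUnion.2 ⟨n, hz.1, fun r hr => ?_⟩
    obtain ⟨x, hxE, hx1, hx2⟩ := hz.2 r hr
    have hc1 : (1 : ℝ) ≤ c := hc
    have hx3 := mem_ball_zero_iff.1 (ePt_ball hη hη1 h.le h1 hxE)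
    have hx4 : 0 ≤ (1 - ‖x‖) ^ γ := Real.rpow_nonneg (by linarith) _
    refine ⟨x, hxE, hx1.trans ?_, ?_⟩
    · gcongr; linarith
    · have := le_of_mul_le_mul_left hx2 (by linarith)
      gcongr
  refine (dimH_mono hsub).trans ?_
  rw [dimH_iUnion]
  refine iSup_le fun n => ?_
  refine le_of_forall_gt fun u hu => ?_
  obtain ⟨v, hv1, hv2⟩ := ENNReal.lt_iff_exists_nnreal_btwn.1 hu
  refine lt_of_le_of_lt ?_ hv2
  have hsv : s < v := by
    have := (ENNReal.ofReal_lt_iff_lt_toReal hs.le ENNReal.coe_ne_top).1 hv1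
    simpa using this
  apply dimH_le_of_hausdorffMeasure_ne_top
  rw [hausdorff_gammaRadialPoints hη hη1 hγ h1 hcs hs hsv (by linarith [n.cast_nonneg (α := ℝ)])]
  simp

/-- **Example (sharpness of the bound `dim_H L_rad^γ(E) ≤ δ(E)/γ`): for `0 < t ≤ γ ≤ 1` there is
a discrete `E ⊆ 𝔻²` with `δ(E) = t` and `dim_H L_rad^γ(E) = t/γ`.** -/
theorem exists_discrete_sharp_gammaRadial (t γ : ℝ)
    (ht : 0 < t) (htγ : t ≤ γ) (hγ1 : γ ≤ 1) :
    ∃ E : Set (Pt 2), E ⊆ ball 0 1 ∧ IsDiscreteSet E ∧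
      critExp E = ENNReal.ofReal t ∧
      dimH (gammaRadialLimitSet E γ) = ENNReal.ofReal (t / γ) := by
  set η : ℝ := 2 ^ (-(1 / t)) with hη
  have hγ : 0 < γ := ht.trans_le htγ
  have h0 : 0 < η := by positivity
  have hη1 : η < 1 := Real.rpow_lt_one_of_one_lt_of_neg (by norm_num) (by
    have : 0 < 1 / t := by positivity
    linarith)
  have hηt : η ^ t = 1 / 2 := by
    rw [hη, ← Real.rpow_mul (by norm_num), neg_mul, one_div, inv_mul_cancel₀ ht.ne',
      Real.rpow_neg_one, one_div]
  have hle : η ^ γ ≤ 1 / 2 := by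
    rw [← hηt]; exact Real.rpow_le_rpow_of_exponent_ge h0 hη1.le htγ
  have hs : 0 < t / γ := by positivity
  have hcs : (η ^ γ) ^ (t / γ) = 1 / 2 := by
    rw [← Real.rpow_mul h0.le, mul_div_cancel₀ _ hγ.ne', hηt]
  have hc : 0 < η ^ γ := by positivity
  exact ⟨range (ePt η (η ^ γ)), ePt_ball h0 hη1 hc.le hle, ePt_discrete h0 hη1 hc.le hle,
    critExp_ePt h0 hη1 hc hle hs hcs ht hηt,
    le_antisymm (dimH_gammaRadial_le h0 hη1 hγ hle hs hcs)
      (le_dimH_gammaRadial h0 hη1 hγ hγ1 hle hs hcs)⟩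

end
end
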